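/- Let ψ: ℕ → [0,1/2], and for n ∈ ℕ let 𝒜_n := ⋃_{0 ≤ a ≤ n, gcd(a,n)=1} [a/n − ψ(n)/n, a/n + ψ(n)/n] ∩ [0,1]. For positive integers n ≠ m set D = D(n,m) := max(m·ψ(n), n·ψ(m))/gcd(n,m). Then for any reals u ≥ 1 and T ≥ 2, λ(𝒜_n ∩ 𝒜_m) ≤ λ(𝒜_n)·λ(𝒜_m)·(1 + O(u^{−u/2} + T^u · log(D+2) · log T / D)) · ∏_{p | nm/gcd(n,m)², p > T} (1 + 1/(p−1)), with an absolute implied constant, where the product is over primes p dividing nm/gcd(n,m)² with p > T and λ denotes Lebesgue measure. -/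

import Mathlib

open MeasureTheory

/-- `𝒜_n = ⋃_{0 ≤ a ≤ n, gcd(a,n)=1} [a/n - ψ(n)/n, a/n + ψ(n)/n] ∩ [0,1]`. -/
noncomputable def DSset (ψ : ℕ → ℝ) (n : ℕ) : Set ℝ :=
  (⋃ a ∈ {a : ℕ | a ≤ n ∧ Nat.Coprime a n},
    Set.Icc ((a : ℝ) / n - ψ n / n) ((a : ℝ) / n + ψ n / n)) ∩ Set.Icc 0 1

/-- `D(n,m) = max(m ψ(n), n ψ(m)) / gcd(n,m)`. -/
noncomputable def Dfun (ψ : ℕ → ℝ) (n m : ℕ) : ℝ :=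
  max ((m : ℝ) * ψ n) ((n : ℝ) * ψ m) / (Nat.gcd n m : ℝ)



lemma my_one_sub_sum (P : Finset ℕ) (x : ℕ → ℝ) (h : ∀ p ∈ P, 0 ≤ x p ∧ x p ≤ 1) :
    1 - ∑ p ∈ P, x p ≤ ∏ p ∈ P, (1 - x p) := by
  induction P using Finset.induction_on with
  | empty => simp
  | insert q P hq ih =>
    rw [Finset.sum_insert hq, Finset.prod_insert hq]
    have ih' := ih (fun p hp => h p (Finset.mem_insert_of_mem hp))
    obtain ⟨h0, h1⟩ := h q (Finset.mem_insert_self _ _)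
    have h2 : 0 ≤ ∑ p ∈ P, x p := Finset.sum_nonneg (fun p hp => (h p (Finset.mem_insert_of_mem hp)).1)
    nlinarith [mul_le_mul_of_nonneg_left ih' (sub_nonneg.2 h1), mul_nonneg h0 h2]

lemma prime_block (i : ℕ) (hi : 1 ≤ i) (A : Finset ℕ)
    (hA : ∀ p ∈ A, p.Prime ∧ 2 ^ i ≤ p ∧ p < 2 ^ (i + 1)) : ∑ p ∈ A, (1 : ℝ) / p ≤ 4 / i := by
  have h1 : (2 ^ i) ^ A.card ≤ 2 ^ (2 ^ (i + 2)) := by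
    calc (2 ^ i) ^ A.card = ∏ p ∈ A, 2 ^ i := by simp
      _ ≤ ∏ p ∈ A, p := Finset.prod_le_prod' (fun p hp => (hA p hp).2.1)
      _ ≤ primorial (2 ^ (i+1)) := by
        rw [primorial_eq_prod_primesLE]
        apply Finset.prod_le_prod_of_subset_of_one_le'
        · intro p hp
          rw [Nat.mem_primesLE]
          exact ⟨(hA p hp).2.2.le, (hA p hp).1⟩
        · intro p hp _
          exact (Nat.prime_of_mem_primesLE hp).one_le
      _ ≤ 4 ^ (2 ^ (i+1)) := primorial_le_four_pow _
      _ = 2 ^ (2 ^ (i + 2)) := by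
        rw [show (4:ℕ) = 2 ^ 2 by norm_num, ← pow_mul]; ring_nf
  rw [← pow_mul] at h1
  have h2 : i * A.card ≤ 2 ^ (i+2) := (Nat.pow_le_pow_iff_right (by norm_num)).1 h1
  calc ∑ p ∈ A, (1 : ℝ) / p ≤ ∑ p ∈ A, (1:ℝ) / 2 ^ i := by
        apply Finset.sum_le_sum
        intro p hp
        apply one_div_le_one_div_of_le (by positivity)
        exact_mod_cast (hA p hp).2.1
    _ = A.card / 2 ^ i := by simp; ring
    _ ≤ 4 / i := by
      rw [div_le_div_iff₀ (by positivity) (by exact_mod_cast hi)]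
      have : ((i * A.card : ℕ) : ℝ) ≤ ((2 ^ (i+2) : ℕ) : ℝ) := by exact_mod_cast h2
      push_cast at this
      rw [pow_add] at this
      linarith

lemma prime_sum (y : ℝ) (hy : 1 ≤ y) (A : Finset ℕ)
    (hA : ∀ p ∈ A, p.Prime ∧ y < p ∧ (p:ℝ) ≤ y ^ 4) : ∑ p ∈ A, (1 : ℝ) / p ≤ 28 := by
  set a := Nat.log 2 ⌊y⌋₊ with ha
  have hf : ⌊y⌋₊ ≠ 0 := by
    have := (Nat.one_le_floor_iff y).2 hy
    omega
  have h1 : (2:ℝ) ^ a ≤ y := by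
    have h := Nat.pow_log_le_self 2 hf
    calc (2:ℝ) ^ a = ((2 ^ a : ℕ) : ℝ) := by push_cast; rfl
      _ ≤ (⌊y⌋₊ : ℝ) := by exact_mod_cast h
      _ ≤ y := Nat.floor_le (by linarith)
  have h2 : y < (2:ℝ) ^ (a+1) := by
    have h := Nat.lt_pow_succ_log_self (b := 2) (by norm_num) ⌊y⌋₊
    have := (Nat.floor_lt (by linarith : 0 ≤ y)).1 h
    push_cast at this
    exact this
  have h4 : y ^ 4 < (2:ℝ) ^ (4 * a + 4) := by
    calc y ^ 4 < ((2:ℝ) ^ (a+1)) ^ 4 := by gcongr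
      _ = _ := by rw [← pow_mul]; ring_nf
  have hm : ∀ p ∈ A, Nat.log 2 p ∈ Finset.Icc (max a 1) (4 * a + 3) := by
    intro p hp
    obtain ⟨hpp, hp1, hp2⟩ := hA p hp
    have e1 : 2 ^ a ≤ p := by
      have : (2:ℝ) ^ a ≤ p := by linarith
      exact_mod_cast this
    have e2 : p < 2 ^ (4 * a + 4) := by
      have : (p:ℝ) < (2:ℝ) ^ (4 * a + 4) := by linarith
      exact_mod_cast this
    rw [Finset.mem_Icc, max_le_iff]
    refine ⟨⟨Nat.le_log_of_pow_le (by norm_num) e1, Nat.le_log_of_pow_le (by norm_num) (by simpa using hpp.two_le)⟩, ?_⟩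
    have := Nat.log_lt_of_lt_pow hpp.ne_zero e2
    omega
  rw [← Finset.sum_fiberwise_of_maps_to hm]
  calc _ ≤ ∑ i ∈ Finset.Icc (max a 1) (4 * a + 3), (4:ℝ) / (max a 1 : ℕ) := by
        apply Finset.sum_le_sum
        intro i hi
        rw [Finset.mem_Icc] at hi
        have hi1 : 1 ≤ i := le_trans (le_max_right _ _) hi.1
        refine (prime_block i hi1 _ ?_).trans ?_
        · intro p hp
          rw [Finset.mem_filter] at hp
          obtain ⟨hp, rfl⟩ := hp
          exact ⟨(hA p hp).1, Nat.pow_log_le_self 2 (hA p hp).1.ne_zero, Nat.lt_pow_succ_log_self (by norm_num) _⟩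
        · have : ((max a 1 : ℕ):ℝ) ≤ i := by exact_mod_cast hi.1
          have : (0:ℝ) < (max a 1 : ℕ) := by positivity
          gcongr
    _ ≤ 28 := by
      rw [Finset.sum_const, Nat.card_Icc, nsmul_eq_mul]
      have hpos : (0:ℝ) < (max a 1 : ℕ) := by positivity
      rw [mul_div_assoc', div_le_iff₀ hpos]
      have : (4 * a + 3 + 1 - max a 1) * 4 ≤ 28 * max a 1 := by omega
      exact_mod_cast this


lemma layer_sieve (P : Finset ℕ) : ∀ k : ℕ, ∃ (ι : Type) (_ : Fintype ι) (S : ι → Finset ℕ) (l : ι → ℝ),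
    (∀ i, S i ⊆ P) ∧ (∀ i, |l i| ≤ 1) ∧ (Fintype.card ι ≤ (P.card + 1) ^ k) ∧
    ∀ x : ℕ → ℝ, (∀ p ∈ P, 0 ≤ x p ∧ x p ≤ 1) →
      0 ≤ (-1) ^ k * (∑ i, l i * ∏ p ∈ S i, x p - ∏ p ∈ P, (1 - x p)) ∧
      ∀ s : ℝ, 0 < s →
      (-1) ^ k * (∑ i, l i * ∏ p ∈ S i, x p - ∏ p ∈ P, (1 - x p)) ≤
        Real.exp (s * ∑ p ∈ P, x p) / s ^ (k + 1) := by
  induction P using Finset.induction_on with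
  | empty =>
    intro k
    refine ⟨Unit, inferInstance, fun _ => ∅, fun _ => 1, by simp, by simp, by simp, ?_⟩
    intro x _
    simp
    intro s hs
    positivity
  | insert q P hq ih =>
    intro k
    cases k with
    | zero =>
      refine ⟨Unit, inferInstance, fun _ => ∅, fun _ => 1, by simp, by simp, by simp, ?_⟩
      intro x hx
      have h1 : ∏ p ∈ insert q P, (1 - x p) ≤ 1 :=
        Finset.prod_le_one (fun p hp => by linarith [(hx p hp).2]) (fun p hp => by linarith [(hx p hp).1])
      have h2 : 1 - ∑ p ∈ insert q P, x p ≤ ∏ p ∈ insert q P, (1 - x p) := 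
        my_one_sub_sum _ x hx
      refine ⟨by simpa using h1, ?_⟩
      intro s hs
      rw [le_div_iff₀ (by positivity)]
      have h3 := Real.add_one_le_exp (s * ∑ p ∈ insert q P, x p)
      simp at h3 h2 ⊢
      nlinarith
    | succ k =>
      obtain ⟨ι, fι, S, l, h1, h2, h3, h4⟩ := ih (k+1)
      obtain ⟨ι', fι', S', l', h1', h2', h3', h4'⟩ := ih k
      refine ⟨ι ⊕ ι', inferInstance, Sum.elim S (fun i => insert q (S' i)), Sum.elim l (fun i => - l' i), ?_, ?_, ?_, ?_⟩
      · rintro (i | i)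
        · exact (h1 i).trans (Finset.subset_insert _ _)
        · exact Finset.insert_subset_insert _ (h1' i)
      · rintro (i | i)
        · exact h2 i
        · simpa using h2' i
      · rw [Fintype.card_sum, Finset.card_insert_of_notMem hq]
        calc _ ≤ (P.card + 1) ^ (k+1) + (P.card + 1) ^ k := by gcongr
          _ = (P.card + 1) ^ k * (P.card + 1 + 1) := by ring
          _ ≤ (P.card + 1 + 1) ^ k * (P.card + 1 + 1) := by gcongr; omega
          _ = _ := by ring
      · intro x hx
        have hxP : ∀ p ∈ P, 0 ≤ x p ∧ x p ≤ 1 := fun p hp => hx p (Finset.mem_insert_of_mem hp)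
        obtain ⟨hq0, hq1⟩ := hx q (Finset.mem_insert_self _ _)
        obtain ⟨a1, a2⟩ := h4 x hxP
        obtain ⟨b1, b2⟩ := h4' x hxP
        have e : (-1) ^ (k+1) * (∑ i, Sum.elim l (fun i => - l' i) i * ∏ p ∈ Sum.elim S (fun i => insert q (S' i)) i, x p - ∏ p ∈ insert q P, (1 - x p)) =
          (-1) ^ (k+1) * (∑ i, l i * ∏ p ∈ S i, x p - ∏ p ∈ P, (1 - x p)) + x q * ((-1) ^ k * (∑ i, l' i * ∏ p ∈ S' i, x p - ∏ p ∈ P, (1 - x p))) := by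
          rw [Fintype.sum_sum_type, Finset.prod_insert hq]
          have : ∀ i, ∏ p ∈ insert q (S' i), x p = x q * ∏ p ∈ S' i, x p := fun i =>
            Finset.prod_insert (fun h => hq (h1' i h))
          simp only [Sum.elim_inl, Sum.elim_inr, this]
          have : ∑ i, -l' i * (x q * ∏ p ∈ S' i, x p) = - x q * ∑ i, l' i * ∏ p ∈ S' i, x p := by
            rw [Finset.mul_sum]; congr 1; ext i; ring
          rw [this]; ring
        rw [e]
        refine ⟨by positivity, ?_⟩
        intro s hs
        rw [Finset.sum_insert hq, mul_add, Real.exp_add]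
        have c1 := a2 s hs
        have c2 := mul_le_mul_of_nonneg_left (b2 s hs) hq0
        have c3 := Real.add_one_le_exp (s * x q)
        calc _ ≤ _ := add_le_add c1 c2
          _ = (s * x q + 1) * (Real.exp (s * ∑ p ∈ P, x p) / s ^ (k+1+1)) := by
            field_simp
            ring
          _ ≤ Real.exp (s * x q) * (Real.exp (s * ∑ p ∈ P, x p) / s ^ (k+1+1)) := by gcongr
          _ = _ := by ring


lemma exp_neg_le_one_sub (x : ℝ) (h0 : 0 ≤ x) (h1 : x ≤ 1/2) : Real.exp (-(2 * x)) ≤ 1 - x := by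
  rw [Real.exp_neg, inv_le_comm₀ (Real.exp_pos _) (by linarith)]
  refine le_trans ?_ (Real.add_one_le_exp _)
  rw [inv_le_iff_one_le_mul₀ (by linarith)]
  nlinarith

lemma prod_lower (P : Finset ℕ) (hP : ∀ p ∈ P, p.Prime) (L : ℝ) (hL : ∑ p ∈ P, (1:ℝ) / p ≤ L) :
    Real.exp (-(2 * L)) ≤ ∏ p ∈ P, (1 - 1 / (p:ℝ)) := by
  calc Real.exp (-(2 * L)) ≤ Real.exp (∑ p ∈ P, -(2 * (1 / (p:ℝ)))) := by
        rw [Real.exp_le_exp, Finset.sum_neg_distrib, ← Finset.mul_sum]; linarith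
    _ = ∏ p ∈ P, Real.exp (-(2 * (1 / (p:ℝ)))) := Real.exp_sum _ _
    _ ≤ _ := by
      apply Finset.prod_le_prod
      · intros; positivity
      · intro p hp
        apply exp_neg_le_one_sub _ (by positivity)
        apply one_div_le_one_div_of_le (by norm_num)
        exact_mod_cast (hP p hp).two_le

lemma full_sieve (s : ℝ) (hs : 2 ≤ s) (j : ℕ) : ∀ (z : ℝ), 1 ≤ z → z < 2 ^ (4 ^ j) → ∀ (b : ℕ) (P : Finset ℕ),
    (∀ p ∈ P, p.Prime ∧ (p:ℝ) ≤ z) →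
    ∃ (ι : Type) (_ : Fintype ι) (S : ι → Finset ℕ) (l : ι → ℝ),
    (∀ i, S i ⊆ P) ∧ (∀ i, |l i| ≤ 1) ∧ ((Fintype.card ι : ℝ) ≤ z ^ ((8 * b / 3 + 1 : ℝ))) ∧
    (∀ x : ℕ → ℝ, (∀ p ∈ P, 0 ≤ x p ∧ x p ≤ 1) →
      ∏ p ∈ P, (1 - x p) ≤ ∑ i, l i * ∏ p ∈ S i, x p) ∧
    ∑ i, l i * ∏ p ∈ S i, (1 / (p:ℝ)) ≤ (∏ p ∈ P, (1 - 1 / (p:ℝ))) * 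
      Real.exp (Real.exp (28 * (s + 2)) / s ^ (2 * b)) := by
  induction j with
  | zero =>
    intro z hz hz2 b P hP
    have hPe : P = ∅ := by
      apply Finset.eq_empty_of_forall_notMem
      intro p hp
      have h1 : (2:ℝ) ≤ p := by exact_mod_cast (hP p hp).1.two_le
      have := (hP p hp).2
      simp at hz2
      linarith
    subst hPe
    refine ⟨Unit, inferInstance, fun _ => ∅, fun _ => 1, by simp, by simp, ?_, by simp, ?_⟩
    · simp
      apply Real.one_le_rpow hz (by positivity)
    · simp
      positivity
  | succ j ih =>
    intro z hz hz2 b P hP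
    set y := z ^ (1/4 : ℝ) with hy
    have hy4 : y ^ 4 = z := by
      rw [hy, ← Real.rpow_natCast, ← Real.rpow_mul (by linarith)]; norm_num
    have hy1 : 1 ≤ y := Real.one_le_rpow hz (by norm_num)
    have hyj : y < 2 ^ (4 ^ j) := by
      apply lt_of_pow_lt_pow_left₀ 4 (by positivity)
      rw [hy4, ← pow_mul, ← pow_succ]; exact hz2
    set P1 := P.filter (fun p : ℕ => (p:ℝ) ≤ y) with hP1
    set P2 := P.filter (fun p : ℕ => ¬ (p:ℝ) ≤ y) with hP2
    have hsplit : ∀ f : ℕ → ℝ, ∏ p ∈ P, f p = (∏ p ∈ P1, f p) * ∏ p ∈ P2, f p := fun f =>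
      (Finset.prod_filter_mul_prod_filter_not P _ f).symm
    obtain ⟨ι, fι, S, l, a1, a2, a3, a4, a5⟩ := ih y hy1 hyj (b+1) P1 (by
      intro p hp; rw [hP1, Finset.mem_filter] at hp; exact ⟨(hP p hp.1).1, hp.2⟩)
    obtain ⟨κ, fκ, S', l', b1, b2, b3, b4⟩ := layer_sieve P2 (2 * b)
    have hsum : ∑ p ∈ P2, (1:ℝ) / p ≤ 28 := by
      apply prime_sum y hy1
      intro p hp
      rw [hP2, Finset.mem_filter] at hp
      refine ⟨(hP p hp.1).1, not_le.1 hp.2, ?_⟩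
      rw [hy4]; exact (hP p hp.1).2
    have hP2prime : ∀ p ∈ P2, p.Prime := fun p hp => (hP p (Finset.mem_filter.1 hp).1).1
    have hP1prime : ∀ p ∈ P1, p.Prime := fun p hp => (hP p (Finset.mem_filter.1 hp).1).1
    have hinv : ∀ Q : Finset ℕ, (∀ p ∈ Q, p.Prime) → ∀ p ∈ Q, 0 ≤ 1 / (p:ℝ) ∧ 1 / (p:ℝ) ≤ 1 := by
      intro Q hQ p hp
      refine ⟨by positivity, ?_⟩
      rw [div_le_one (by exact_mod_cast (hQ p hp).pos)]
      exact_mod_cast (hQ p hp).one_le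
    have hdisj : ∀ i k, Disjoint (S i) (S' k) := fun i k =>
      Finset.disjoint_of_subset_left (a1 i) (Finset.disjoint_of_subset_right (b1 k)
        (Finset.disjoint_filter_filter_not P P _))
    have hprodsum : ∀ x : ℕ → ℝ, ∑ i : ι × κ, (l i.1 * l' i.2) * ∏ p ∈ S i.1 ∪ S' i.2, x p =
        (∑ i, l i * ∏ p ∈ S i, x p) * ∑ i, l' i * ∏ p ∈ S' i, x p := by
      intro x
      rw [Finset.sum_mul_sum, Fintype.sum_prod_type]
      refine Finset.sum_congr rfl fun i _ => Finset.sum_congr rfl fun k _ => ?_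
      rw [Finset.prod_union (hdisj i k)]; ring
    refine ⟨ι × κ, inferInstance, fun i => S i.1 ∪ S' i.2, fun i => l i.1 * l' i.2, ?_, ?_, ?_, ?_, ?_⟩
    · intro i
      exact Finset.union_subset ((a1 _).trans (Finset.filter_subset _ _)) ((b1 _).trans (Finset.filter_subset _ _))
    · intro i
      rw [abs_mul]
      exact mul_le_one₀ (a2 _) (abs_nonneg _) (b2 _)
    · rw [Fintype.card_prod]
      push_cast
      have hc : ((P2.card : ℝ) + 1) ≤ z := by
        have : P2 ⊆ Finset.Icc 2 ⌊z⌋₊ := by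
          intro p hp
          rw [Finset.mem_Icc]
          exact ⟨(hP2prime p hp).two_le, Nat.le_floor (hP p (Finset.mem_filter.1 hp).1).2⟩
        have h1 := Finset.card_le_card this
        rw [Nat.card_Icc] at h1
        have h2 : 1 ≤ ⌊z⌋₊ := (Nat.one_le_floor_iff z).2 hz
        have h3 : P2.card + 1 ≤ ⌊z⌋₊ := by omega
        calc ((P2.card : ℝ) + 1) ≤ (⌊z⌋₊ : ℝ) := by exact_mod_cast h3
          _ ≤ z := Nat.floor_le (by linarith)
      have hb3 : (Fintype.card κ : ℝ) ≤ z ^ (2 * b) := by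
        calc (Fintype.card κ : ℝ) ≤ ((P2.card : ℝ) + 1) ^ (2 * b) := by exact_mod_cast b3
          _ ≤ z ^ (2 * b) := by gcongr
      calc (Fintype.card ι : ℝ) * (Fintype.card κ : ℝ) ≤ y ^ ((8 * ((b + 1 : ℕ) : ℝ) / 3 + 1 : ℝ)) * z ^ (2 * b) := by
            gcongr
        _ = z ^ ((1/4 : ℝ) * (8 * ((b + 1 : ℕ) : ℝ) / 3 + 1) + (2 * b : ℕ)) := by
            rw [hy, ← Real.rpow_mul (by linarith), Real.rpow_add (by linarith), Real.rpow_natCast]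
        _ ≤ _ := by
            apply Real.rpow_le_rpow_of_exponent_le hz
            push_cast
            linarith
    · intro x hx
      rw [hprodsum, hsplit]
      have c1 := a4 x (fun p hp => hx p (Finset.mem_filter.1 hp).1)
      have c2 := (b4 x (fun p hp => hx p (Finset.mem_filter.1 hp).1)).1
      rw [Even.neg_one_pow (by simp), one_mul, sub_nonneg] at c2
      have d1 : 0 ≤ ∏ p ∈ P1, (1 - x p) := Finset.prod_nonneg fun p hp => by
        linarith [(hx p (Finset.mem_filter.1 hp).1).2]
      have d2 : 0 ≤ ∏ p ∈ P2, (1 - x p) := Finset.prod_nonneg fun p hp => by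
        linarith [(hx p (Finset.mem_filter.1 hp).1).2]
      exact mul_le_mul c1 c2 d2 (d1.trans c1)
    · rw [hprodsum, hsplit]
      obtain ⟨c1, c2⟩ := b4 (fun p => 1 / (p:ℝ)) (hinv _ hP2prime)
      have c2 := c2 s (by linarith)
      rw [Even.neg_one_pow (by simp), one_mul] at c1 c2
      have hV := prod_lower P2 hP2prime 28 hsum
      set V := ∏ p ∈ P2, (1 - 1 / (p:ℝ)) with hVdef
      set Φ := ∑ i, l' i * ∏ p ∈ S' i, (1 / (p:ℝ)) with hΦ
      have hV0 : 0 < V := lt_of_lt_of_le (Real.exp_pos _) hV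
      have hs0 : (0:ℝ) < s := by linarith
      have e1 : Φ ≤ V * Real.exp (Real.exp (28 * (s + 2)) / s ^ (2 * b + 1)) := by
        have : Real.exp (s * ∑ p ∈ P2, 1 / (p:ℝ)) / s ^ (2*b+1) ≤ V * (Real.exp (28 * (s + 2)) / s ^ (2 * b + 1)) := by
          rw [← mul_div_assoc]
          gcongr
          calc Real.exp (s * ∑ p ∈ P2, 1 / (p:ℝ)) ≤ Real.exp (s * 28) := by
                rw [Real.exp_le_exp]; gcongr
            _ = Real.exp (-(2 * 28)) * Real.exp (28 * (s + 2)) := by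
                rw [← Real.exp_add]; ring_nf
            _ ≤ _ := by gcongr
        have h3 := Real.add_one_le_exp (Real.exp (28 * (s + 2)) / s ^ (2 * b + 1))
        nlinarith
      have d1 : 0 ≤ ∏ p ∈ P1, (1 - 1 / (p:ℝ)) := Finset.prod_nonneg fun p hp => by
        linarith [(hinv _ hP1prime p hp).2]
      have hΦ0 : 0 ≤ Φ := by linarith
      calc _ ≤ ((∏ p ∈ P1, (1 - 1 / (p:ℝ))) * Real.exp (Real.exp (28 * (s + 2)) / s ^ (2 * (b + 1)))) * 
            (V * Real.exp (Real.exp (28 * (s + 2)) / s ^ (2 * b + 1))) := by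
            apply mul_le_mul a5 e1 hΦ0 (by positivity)
        _ = (∏ p ∈ P1, (1 - 1 / (p:ℝ))) * V * Real.exp (Real.exp (28 * (s + 2)) / s ^ (2 * (b + 1)) + Real.exp (28 * (s + 2)) / s ^ (2 * b + 1)) := by
            rw [Real.exp_add]; ring
        _ ≤ _ := by
          gcongr
          set E := Real.exp (28 * (s + 2)) with hE
          have hE0 : 0 < E := Real.exp_pos _
          have q1 : E / s ^ (2 * (b + 1)) + E / s ^ (2 * b + 1) = E / s ^ (2 * b) * ((1 + s) / s ^ 2) := by
            field_simp
            ring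
          rw [q1]
          apply mul_le_of_le_one_right (by positivity)
          rw [div_le_one (by positivity)]
          nlinarith


noncomputable def Gsum (β : ℕ → ℝ) (R : Finset ℕ) (X : ℝ) : ℝ :=
  ∑ S ∈ R.powerset, if ((∏ p ∈ S, p : ℕ) : ℝ) ≤ X then ∏ p ∈ S, β p else 0

lemma Gsum_insert (β : ℕ → ℝ) (R : Finset ℕ) (q : ℕ) (hq : q ∉ R) (hq0 : 0 < q) (X : ℝ) :
    Gsum β (insert q R) X = Gsum β R X + β q * Gsum β R (X / q) := by
  unfold Gsum
  rw [Finset.sum_powerset_insert hq, Finset.mul_sum]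
  congr 1
  refine Finset.sum_congr rfl fun S hS => ?_
  have hqS : q ∉ S := fun h => hq (Finset.mem_powerset.1 hS h)
  rw [Finset.prod_insert hqS, Finset.prod_insert hqS]
  have hq1 : (0:ℝ) < q := by exact_mod_cast hq0
  have hiff : ((q * ∏ p ∈ S, p : ℕ) : ℝ) ≤ X ↔ ((∏ p ∈ S, p : ℕ) : ℝ) ≤ X / q := by
    rw [le_div_iff₀ hq1]
    push_cast
    rw [mul_comm (q:ℝ)]
  by_cases h : ((∏ p ∈ S, p : ℕ) : ℝ) ≤ X / q
  · rw [if_pos h, if_pos (hiff.2 h)]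
  · rw [if_neg h, if_neg (fun h' => h (hiff.1 h')), mul_zero]

lemma Gsum_mono (β : ℕ → ℝ) (hβ : ∀ p, 0 ≤ β p) (R : Finset ℕ) {X Y : ℝ} (h : X ≤ Y) : Gsum β R X ≤ Gsum β R Y := by
  unfold Gsum
  refine Finset.sum_le_sum fun S hS => ?_
  have : 0 ≤ ∏ p ∈ S, β p := Finset.prod_nonneg fun p _ => hβ p
  split_ifs with h1 h2 h2
  · rfl
  · exact absurd (h1.trans h) h2
  · exact this
  · rfl

lemma Gsum_nonneg (β : ℕ → ℝ) (hβ : ∀ p, 0 ≤ β p) (R : Finset ℕ) (X : ℝ) : 0 ≤ Gsum β R X := by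
  unfold Gsum
  refine Finset.sum_nonneg fun S hS => ?_
  have : 0 ≤ ∏ p ∈ S, β p := Finset.prod_nonneg fun p _ => hβ p
  split_ifs <;> positivity

lemma Gsum_compare (δ : ℕ → ℝ) (hδ : ∀ p, 0 ≤ δ p) (R : Finset ℕ) (hR : ∀ p ∈ R, p.Prime) : ∀ X : ℝ, 0 ≤ X →
    Gsum (fun p => 1 / (p:ℝ) + δ p) R X ≤ (∏ p ∈ R, (1 + δ p)) * Gsum (fun p => 1 / (p:ℝ)) R X := by
  induction R using Finset.induction_on with
  | empty => intro X _; simp [Gsum]; exact le_refl _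
  | insert q R hq ih =>
    intro X hX
    have hq0 := (hR q (Finset.mem_insert_self _ _)).pos
    have ih' := ih (fun p hp => hR p (Finset.mem_insert_of_mem hp))
    rw [Gsum_insert _ _ _ hq hq0, Gsum_insert _ _ _ hq hq0, Finset.prod_insert hq]
    have hP : 0 ≤ ∏ p ∈ R, (1 + δ p) := Finset.prod_nonneg fun p _ => by linarith [hδ p]
    have hXq : X / q ≤ X := div_le_self hX (by exact_mod_cast hq0)
    have h1 := ih' X hX
    have h2 := ih' (X / q) (by positivity)
    have hn : ∀ p : ℕ, 0 ≤ (fun p : ℕ => 1 / (p:ℝ)) p := fun p => by positivity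
    have h3 := Gsum_mono _ hn R hXq
    have h4 := Gsum_nonneg _ hn R (X / q)
    have hb : 0 ≤ 1 / (q:ℝ) + δ q := by have := hδ q; positivity
    have h5 := mul_le_mul_of_nonneg_left h2 hb
    set W := ∏ p ∈ R, (1 + δ p)
    set A := Gsum (fun p => 1 / (p:ℝ)) R X
    set B := Gsum (fun p => 1 / (p:ℝ)) R (X / q)
    have hq1 : 0 ≤ 1 / (q:ℝ) := by positivity
    have hδq := hδ q
    have : 0 ≤ W * δ q * (A - B + 1 / (q:ℝ) * B) := by
      apply mul_nonneg (mul_nonneg hP hδq)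
      have := mul_nonneg hq1 h4
      linarith
    calc _ ≤ W * A + (1 / (q:ℝ) + δ q) * (W * B) := add_le_add h1 h5
      _ ≤ _ := by linarith

lemma Gsum_harm (R : Finset ℕ) (hR : ∀ p ∈ R, p.Prime) (X : ℝ) (hX : 1 ≤ X) :
    Gsum (fun p => 1 / (p:ℝ)) R X ≤ 1 + Real.log X := by
  unfold Gsum
  rw [← Finset.sum_filter]
  have hinj : Set.InjOn (fun S : Finset ℕ => ∏ p ∈ S, p) (R.powerset.filter (fun S => ((∏ p ∈ S, p : ℕ) : ℝ) ≤ X) : Set (Finset ℕ)) := by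
    intro S hS U hU h
    simp only [Finset.coe_filter, Finset.mem_powerset, Set.mem_ofPred_eq] at hS hU
    have h1 := Nat.primeFactors_prod (fun p hp => hR p (hS.1 hp))
    have h2 := Nat.primeFactors_prod (fun p hp => hR p (hU.1 hp))
    simp only at h
    rw [← h1, ← h2, h]
  have : ∑ S ∈ R.powerset.filter (fun S => ((∏ p ∈ S, p : ℕ) : ℝ) ≤ X), ∏ p ∈ S, 1 / (p:ℝ) =
     ∑ d ∈ (R.powerset.filter (fun S => ((∏ p ∈ S, p : ℕ) : ℝ) ≤ X)).image (fun S => ∏ p ∈ S, p), (d:ℝ)⁻¹ := by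
    rw [Finset.sum_image hinj]
    refine Finset.sum_congr rfl fun S _ => ?_
    push_cast
    rw [← Finset.prod_inv_distrib]; simp
  rw [this]
  refine le_trans ?_ (harmonic_floor_le_one_add_log X hX)
  rw [harmonic_eq_sum_Icc]
  push_cast
  apply Finset.sum_le_sum_of_subset_of_nonneg
  · intro d hd
    rw [Finset.mem_image] at hd
    obtain ⟨S, hS, rfl⟩ := hd
    rw [Finset.mem_filter, Finset.mem_powerset] at hS
    rw [Finset.mem_Icc]
    exact ⟨Finset.prod_pos fun p hp => (hR p (hS.1 hp)).pos, Nat.le_floor (by push_cast; exact hS.2)⟩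
  · intros; positivity

lemma sum_sq_inv (N : ℕ) : ∑ k ∈ Finset.Icc 2 N, (1:ℝ) / (k:ℝ) ^ 2 ≤ 1 := by
  have : ∀ N : ℕ, ∑ k ∈ Finset.Icc 2 (N + 1), (1:ℝ) / (k:ℝ) ^ 2 ≤ 1 - 1 / ((N:ℝ) + 1) := by
    intro N
    induction N with
    | zero => simp
    | succ N ih =>
      rw [Finset.sum_Icc_succ_top (by omega)]
      refine (add_le_add_left ih _).trans ?_
      push_cast
      have : 1 / ((N:ℝ) + 1 + 1) ^ 2 ≤ 1 / ((N:ℝ) + 1) - 1 / ((N:ℝ) + 1 + 1) := by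
        rw [div_sub_div _ _ (by positivity) (by positivity), div_le_div_iff₀ (by positivity) (by positivity)]
        nlinarith
      linarith
  cases N with
  | zero => simp
  | succ N =>
    refine (this N).trans ?_
    have : 0 ≤ 1 / ((N:ℝ) + 1) := by positivity
    linarith

noncomputable def betaf (p : ℕ) : ℝ := (p:ℝ) / ((p:ℝ) - 1) ^ 2

lemma Gsum_beta (R : Finset ℕ) (hR : ∀ p ∈ R, p.Prime) (X : ℝ) (hX : 1 ≤ X) :
    Gsum betaf R X ≤ Real.exp 8 * (1 + Real.log X) := by
  have h1 : Gsum betaf R X ≤ Gsum (fun p => 1 / (p:ℝ) + 8 / (p:ℝ) ^ 2) R X := by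
    unfold Gsum
    refine Finset.sum_le_sum fun S hS => ?_
    rw [Finset.mem_powerset] at hS
    split_ifs
    · apply Finset.prod_le_prod
      · intro p hp; unfold betaf; positivity
      · intro p hp
        have h2 : (2:ℝ) ≤ p := by exact_mod_cast (hR p (hS hp)).two_le
        unfold betaf
        have h3 : (0:ℝ) < (p:ℝ) - 1 := by linarith
        rw [div_add_div _ _ (by positivity) (by positivity), div_le_div_iff₀ (by positivity) (by positivity)]
        have h4 : 0 ≤ (p:ℝ) * (6 * p ^ 2 - 15 * p + 8) := by
          apply mul_nonneg (by positivity); nlinarith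
        nlinarith [h4]
    · rfl
  refine h1.trans ((Gsum_compare _ (fun p => by positivity) R hR X (by linarith)).trans ?_)
  have hh := Gsum_harm R hR X hX
  have hl := Real.log_nonneg hX
  refine mul_le_mul ?_ hh (Gsum_nonneg _ (fun p => by positivity) _ _) (by positivity)
  calc ∏ p ∈ R, (1 + 8 / (p:ℝ) ^ 2) ≤ ∏ p ∈ R, Real.exp (8 / (p:ℝ)^2) := by
        apply Finset.prod_le_prod
        · intros; positivity
        · intro p _; rw [add_comm]; exact Real.add_one_le_exp _
    _ = Real.exp (∑ p ∈ R, 8 / (p:ℝ)^2) := (Real.exp_sum _ _).symm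
    _ ≤ _ := by
      rw [Real.exp_le_exp]
      calc ∑ p ∈ R, 8 / (p:ℝ)^2 ≤ ∑ p ∈ Finset.Icc 2 (R.sup id), 8 / (p:ℝ)^2 := by
            apply Finset.sum_le_sum_of_subset_of_nonneg
            · intro p hp
              rw [Finset.mem_Icc]
              exact ⟨(hR p hp).two_le, Finset.le_sup (f := id) hp⟩
            · intros; positivity
        _ = 8 * ∑ p ∈ Finset.Icc 2 (R.sup id), 1 / (p:ℝ)^2 := by
            rw [Finset.mul_sum]; refine Finset.sum_congr rfl fun _ _ => by ring
        _ ≤ 8 := by linarith [sum_sq_inv (R.sup id)]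


noncomputable def trap (A B x : ℝ) : ℝ := max 0 (A - x) - max 0 (B - x)

lemma trap_nonneg {A B : ℝ} (h : B ≤ A) (x : ℝ) : 0 ≤ trap A B x := by
  unfold trap
  have : max 0 (B - x) ≤ max 0 (A - x) := max_le_max le_rfl (by linarith)
  linarith

lemma trap_zero {A B x : ℝ} (h : B ≤ A) (hx : A ≤ x) : trap A B x = 0 := by
  unfold trap
  rw [max_eq_left (by linarith), max_eq_left (by linarith)]; simp

lemma trap_step_aux (a b η : ℝ) (hb : 0 ≤ b) (hab : b ≤ a) (hη : 0 < η) :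
    η * (max 0 (a - η) - max 0 (b - η)) ≤ (a ^ 2 - (max 0 (a - η)) ^ 2 - b ^ 2 + (max 0 (b - η)) ^ 2) / 2 ∧
    (a ^ 2 - (max 0 (a - η)) ^ 2 - b ^ 2 + (max 0 (b - η)) ^ 2) / 2 ≤ η * (a - b) := by
  rcases le_total a η with h1 | h1 <;> rcases le_total b η with h2 | h2
  · rw [max_eq_left (by linarith), max_eq_left (by linarith)]
    constructor <;> nlinarith
  · rw [max_eq_left (by linarith), max_eq_right (by linarith)]
    constructor <;> nlinarith
  · rw [max_eq_right (by linarith), max_eq_left (by linarith)]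
    constructor <;> nlinarith
  · rw [max_eq_right (by linarith), max_eq_right (by linarith)]
    constructor <;> nlinarith

lemma trap_sum (A B η : ℝ) (hB : 0 ≤ B) (hBA : B ≤ A) (hη : 0 < η) (M : ℕ) (hM : A ≤ M * η) :
    |∑ k ∈ Finset.range M, trap A B ((k + 1 : ℝ) * η) - (A ^ 2 - B ^ 2) / (2 * η)| ≤ A - B := by
  set F : ℕ → ℝ := fun k => (-(max 0 (A - k * η)) ^ 2 + (max 0 (B - k * η)) ^ 2) / 2 with hF
  have hmax : ∀ (A : ℝ) (k : ℕ), max 0 (A - ((k + 1 : ℕ):ℝ) * η) = max 0 (max 0 (A - k * η) - η) := by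
    intro A k
    push_cast
    rcases le_total 0 (A - k * η) with h | h
    · rw [max_eq_right h]; congr 1; ring
    · rw [max_eq_left h, max_eq_left (by linarith), max_eq_left (by linarith)]
  have key : ∀ k : ℕ, η * trap A B ((k + 1 : ℝ) * η) ≤ F (k + 1) - F k ∧ F (k+1) - F k ≤ η * trap A B (k * η) := by
    intro k
    have := trap_step_aux (max 0 (A - k * η)) (max 0 (B - k * η)) η (le_max_left _ _) (max_le_max le_rfl (by linarith)) hη
    rw [← hmax, ← hmax] at this
    unfold trap
    simp only [hF]
    push_cast at this ⊢
    constructor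
    · linarith [this.1]
    · linarith [this.2]
  have htel : ∑ k ∈ Finset.range M, (F (k + 1) - F k) = (A ^ 2 - B ^ 2) / 2 := by
    rw [Finset.sum_range_sub]
    simp only [hF]
    rw [max_eq_left (by linarith : A - M * η ≤ 0), max_eq_left (by linarith : B - M * η ≤ 0)]
    push_cast
    rw [max_eq_right (by linarith), max_eq_right (by linarith)]
    ring
  have hup : η * ∑ k ∈ Finset.range M, trap A B ((k + 1 : ℝ) * η) ≤ (A ^ 2 - B ^ 2) / 2 := by
    rw [← htel, Finset.mul_sum]
    exact Finset.sum_le_sum fun k _ => (key k).1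
  have hlo : (A ^ 2 - B ^ 2) / 2 ≤ η * ∑ k ∈ Finset.range M, trap A B ((k:ℝ) * η) := by
    rw [← htel, Finset.mul_sum]
    exact Finset.sum_le_sum fun k _ => (key k).2
  have hshift : ∑ k ∈ Finset.range M, trap A B ((k:ℝ) * η) ≤ ∑ k ∈ Finset.range M, trap A B ((k + 1 : ℝ) * η) + (A - B) := by
    have h1 := Finset.sum_range_succ (fun k : ℕ => trap A B ((k:ℝ) * η)) M
    have h2 := Finset.sum_range_succ' (fun k : ℕ => trap A B ((k:ℝ) * η)) M
    have h3 := trap_nonneg hBA ((M:ℝ) * η)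
    have h4 : trap A B ((0:ℕ) * η) = A - B := by
      unfold trap; push_cast; rw [max_eq_right (by linarith), max_eq_right (by linarith)]; ring
    push_cast at h1 h2 h4
    rw [h4] at h2
    linarith
  have e : (A ^ 2 - B ^ 2) / (2 * η) = ((A ^ 2 - B ^ 2) / 2) / η := by field_simp
  rw [abs_le, e]
  constructor
  · have : (A ^ 2 - B ^ 2) / 2 / η ≤ ∑ k ∈ Finset.range M, trap A B ((k:ℝ) * η) := by
      rw [div_le_iff₀ hη]; linarith
    linarith
  · have : ∑ k ∈ Finset.range M, trap A B ((k + 1 : ℝ) * η) ≤ (A ^ 2 - B ^ 2) / 2 / η := by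
      rw [le_div_iff₀ hη]; linarith
    linarith

lemma trap_sum_dvd (A B N : ℝ) (hB : 0 ≤ B) (hBA : B ≤ A) (hN : 0 < N) (M : ℕ) (hM : A * N ≤ M) (q : ℕ) (hq : 0 < q) :
    |∑ c ∈ Finset.Icc 1 M, (if q ∣ c then trap A B (c / N) else 0) - N * (A ^ 2 - B ^ 2) / (2 * q)| ≤ A - B := by
  have hq1 : (1:ℝ) ≤ q := by exact_mod_cast hq
  have hη : 0 < (q:ℝ) / N := by positivity
  have h := trap_sum A B (q / N) hB hBA hη M (by
    rw [mul_div_assoc', le_div_iff₀ hN]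
    nlinarith [Nat.cast_nonneg (α := ℝ) M])
  have e1 : (A ^ 2 - B ^ 2) / (2 * (q / N)) = N * (A ^ 2 - B ^ 2) / (2 * q) := by field_simp
  have e2 : ∑ c ∈ Finset.Icc 1 M, (if q ∣ c then trap A B (c / N) else 0) = ∑ k ∈ Finset.range M, trap A B ((k + 1 : ℝ) * (q / N)) := by
    rw [← Finset.sum_filter]
    symm
    have e3 : ∑ k ∈ Finset.range M, trap A B ((k + 1 : ℝ) * (q / N)) = ∑ k ∈ (Finset.range M).filter (fun k => (k+1) * q ≤ M), trap A B ((k + 1 : ℝ) * (q / N)) := by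
      rw [Finset.sum_filter]
      refine Finset.sum_congr rfl fun k _ => ?_
      split_ifs with hk
      · rfl
      · apply trap_zero hBA
        rw [mul_div_assoc', le_div_iff₀ hN]
        have : (M:ℝ) ≤ ((k+1) * q : ℕ) := by exact_mod_cast (not_le.1 hk).le
        push_cast at this
        linarith
    rw [e3]
    refine Finset.sum_bij (fun k _ => (k+1) * q) ?_ ?_ ?_ ?_
    · intro k hk
      rw [Finset.mem_filter] at hk
      rw [Finset.mem_filter, Finset.mem_Icc]
      exact ⟨⟨Nat.mul_pos (by omega) hq, hk.2⟩, Dvd.intro_left _ rfl⟩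
    · intro a _ b _ hab
      have := Nat.eq_of_mul_eq_mul_right hq hab
      omega
    · intro c hc
      rw [Finset.mem_filter, Finset.mem_Icc] at hc
      obtain ⟨⟨h1, h2⟩, d, rfl⟩ := hc
      have hd : 0 < d := Nat.pos_of_ne_zero (by rintro rfl; simp at h1)
      refine ⟨d - 1, ?_, ?_⟩
      · rw [Finset.mem_filter, Finset.mem_range, Nat.sub_add_cancel hd, mul_comm]
        refine ⟨?_, h2⟩
        have : d ≤ q * d := Nat.le_mul_of_pos_left d hq
        omega
      · rw [Nat.sub_add_cancel hd, mul_comm]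
    · intro k _
      congr 1
      push_cast
      ring
  rw [e2, ← e1]
  exact h

noncomputable def alphaf (p : ℕ) : ℝ := 1 - 1 / ((p:ℝ) - 1) ^ 2

lemma prod_dvd_ind (S : Finset ℕ) (hS : ∀ p ∈ S, p.Prime) (c : ℕ) :
    ∏ p ∈ S, (if p ∣ c then (1:ℝ) else 0) = if (∏ p ∈ S, p) ∣ c then 1 else 0 := by
  rw [Finset.prod_ite_zero]
  simp only [Finset.prod_const_one]
  have : (∀ p ∈ S, p ∣ c) ↔ (∏ p ∈ S, p) ∣ c := by
    constructor
    · intro h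
      exact Finset.prod_primes_dvd c (fun p hp => (hS p hp).prime) h
    · intro h p hp
      exact (Finset.dvd_prod_of_mem (fun p => p) hp).trans h
  by_cases h : (∏ p ∈ S, p) ∣ c
  · rw [if_pos h, if_pos (this.2 h)]
  · rw [if_neg h, if_neg (fun h' => h (this.1 h'))]

lemma core_sum (A B N : ℝ) (hB : 0 ≤ B) (hBA : B ≤ A) (hN : 0 < N) (M : ℕ) (hM : A * N ≤ M)
    (R P : Finset ℕ) (hR : ∀ p ∈ R, p.Prime) (hP : ∀ p ∈ P, p.Prime) (hRP : Disjoint R P)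
    (ι : Type) [Fintype ι] (S : ι → Finset ℕ) (l : ι → ℝ) (hS : ∀ i, S i ⊆ P) (hl : ∀ i, |l i| ≤ 1)
    (hsieve : ∀ x : ℕ → ℝ, (∀ p ∈ P, 0 ≤ x p ∧ x p ≤ 1) →
      ∏ p ∈ P, (1 - x p) ≤ ∑ i, l i * ∏ p ∈ S i, x p) :
    ∑ c ∈ Finset.Icc 1 M, trap A B (c / N) * (∏ p ∈ P, (1 - if p ∣ c then (1:ℝ) else 0)) *
      ∏ p ∈ R, (betaf p * (if p ∣ c then (1:ℝ) else 0) + alphaf p) ≤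
    N * (A ^ 2 - B ^ 2) / 2 * (∑ i, l i * ∏ p ∈ S i, (1 / (p:ℝ))) +
      (A - B) * Fintype.card ι * Gsum betaf R (A * N) := by
  have hα : ∀ p ∈ R, 0 ≤ alphaf p ∧ alphaf p ≤ 1 := by
    intro p hp
    have h2 : (2:ℝ) ≤ p := by exact_mod_cast (hR p hp).two_le
    unfold alphaf
    have h3 : (1:ℝ) ≤ ((p:ℝ) - 1) ^ 2 := by nlinarith
    have h4 : 1 / ((p:ℝ) - 1) ^ 2 ≤ 1 := by rw [div_le_one (by linarith)]; exact h3
    have h5 : 0 ≤ 1 / ((p:ℝ) - 1) ^ 2 := by positivity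
    constructor <;> linarith
  have hβ : ∀ p, 0 ≤ betaf p := fun p => by unfold betaf; positivity
  set h : Finset ℕ → ℝ := fun U => (∏ p ∈ U, betaf p) * ∏ p ∈ R \ U, alphaf p with hh
  have hh0 : ∀ U, 0 ≤ h U := fun U => mul_nonneg (Finset.prod_nonneg fun p _ => hβ p)
    (Finset.prod_nonneg fun p hp => (hα p (Finset.mem_sdiff.1 hp).1).1)
  have hhβ : ∀ U, h U ≤ ∏ p ∈ U, betaf p := fun U => 
    mul_le_of_le_one_right (Finset.prod_nonneg fun p _ => hβ p)
      (Finset.prod_le_one (fun p hp => (hα p (Finset.mem_sdiff.1 hp).1).1) (fun p hp => (hα p (Finset.mem_sdiff.1 hp).1).2))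
  set d : Finset ℕ → ℕ := fun U => ∏ p ∈ U, p with hd
  have hexp : ∀ c : ℕ, ∏ p ∈ R, (betaf p * (if p ∣ c then (1:ℝ) else 0) + alphaf p) =
      ∑ U ∈ R.powerset, h U * (if d U ∣ c then 1 else 0) := by
    intro c
    rw [Finset.prod_add]
    refine Finset.sum_congr rfl fun U hU => ?_
    rw [Finset.mem_powerset] at hU
    rw [Finset.prod_mul_distrib, prod_dvd_ind U (fun p hp => hR p (hU hp))]
    simp only [hh]; ring
  have hsum1 : ∑ U ∈ R.powerset, h U * (1 / (d U : ℝ)) = 1 := by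
    have := Finset.prod_add (fun p : ℕ => betaf p * (1 / (p:ℝ))) alphaf R
    have e : ∏ p ∈ R, (betaf p * (1 / (p:ℝ)) + alphaf p) = 1 := by
      apply Finset.prod_eq_one
      intro p hp
      have h2 : (2:ℝ) ≤ p := by exact_mod_cast (hR p hp).two_le
      have h3 : (p:ℝ) - 1 ≠ 0 := by linarith
      unfold betaf alphaf
      field_simp
      ring
    rw [e] at this
    refine Eq.trans ?_ this.symm
    refine Finset.sum_congr rfl fun U hU => ?_
    rw [Finset.prod_mul_distrib]
    simp only [hh, hd]
    push_cast
    rw [show ∏ p ∈ U, 1 / (p:ℝ) = 1 / ∏ p ∈ U, (p:ℝ) by simp]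
    ring
  have hΦ0 : 0 ≤ ∑ i, l i * ∏ p ∈ S i, (1 / (p:ℝ)) := by
    have hinv : ∀ p ∈ P, 0 ≤ 1 / (p:ℝ) ∧ 1 / (p:ℝ) ≤ 1 := by
      intro p hp
      refine ⟨by positivity, ?_⟩
      rw [div_le_one (by exact_mod_cast (hP p hp).pos)]
      exact_mod_cast (hP p hp).one_le
    refine le_trans ?_ (hsieve (fun p => 1 / (p:ℝ)) hinv)
    exact Finset.prod_nonneg fun p hp => by linarith [(hinv p hp).2]
  have hI : 0 ≤ N * (A ^ 2 - B ^ 2) / 2 := by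
    have : 0 ≤ A ^ 2 - B ^ 2 := by nlinarith
    positivity
  -- pointwise
  have step1 : ∀ c ∈ Finset.Icc 1 M, trap A B (c / N) * (∏ p ∈ P, (1 - if p ∣ c then (1:ℝ) else 0)) *
      ∏ p ∈ R, (betaf p * (if p ∣ c then (1:ℝ) else 0) + alphaf p) ≤
      ∑ U ∈ R.powerset, h U * ∑ i, l i * (if d U * d (S i) ∣ c then trap A B (c / N) else 0) := by
    intro c _
    have s1 : ∏ p ∈ P, (1 - if p ∣ c then (1:ℝ) else 0) ≤ ∑ i, l i * (if d (S i) ∣ c then 1 else 0) := by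
      have := hsieve (fun p => if p ∣ c then (1:ℝ) else 0) (by intro p _; split_ifs <;> norm_num)
      refine this.trans (le_of_eq ?_)
      refine Finset.sum_congr rfl fun i _ => ?_
      rw [prod_dvd_ind _ (fun p hp => hP p (hS i hp))]
    have s0 : 0 ≤ ∏ p ∈ R, (betaf p * (if p ∣ c then (1:ℝ) else 0) + alphaf p) := by
      apply Finset.prod_nonneg
      intro p hp
      have := hβ p
      have := (hα p hp).1
      split_ifs <;> simp <;> linarith
    have s2 := mul_le_mul_of_nonneg_right (mul_le_mul_of_nonneg_left s1 (trap_nonneg hBA ((c:ℝ) / N))) s0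
    refine s2.trans (le_of_eq ?_)
    rw [hexp, Finset.mul_sum]
    refine Finset.sum_congr rfl fun U hU => ?_
    rw [Finset.mem_powerset] at hU
    rw [Finset.mul_sum, Finset.mul_sum, Finset.sum_mul]
    refine Finset.sum_congr rfl fun i _ => ?_
    have hcop : Nat.Coprime (d U) (d (S i)) := by
      apply Nat.Coprime.prod_left
      intro p hp
      apply Nat.Coprime.prod_right
      intro q hq
      rw [Nat.coprime_primes (hR p (hU hp)) (hP q (hS i hq))]
      rintro rfl
      exact Finset.disjoint_left.1 hRP (hU hp) (hS i hq)
    have hiff : d U * d (S i) ∣ c ↔ d U ∣ c ∧ d (S i) ∣ c :=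
      ⟨fun h => ⟨(dvd_mul_right _ _).trans h, (dvd_mul_left _ _).trans h⟩, fun h => hcop.mul_dvd_of_dvd_of_dvd h.1 h.2⟩
    by_cases h1 : d U ∣ c <;> by_cases h2 : d (S i) ∣ c
    · rw [if_pos h1, if_pos h2, if_pos (hiff.2 ⟨h1, h2⟩)]; ring
    · rw [if_pos h1, if_neg h2, if_neg (fun h => h2 (hiff.1 h).2)]; ring
    · rw [if_neg h1, if_neg (fun h => h1 (hiff.1 h).1)]; ring
    · rw [if_neg h1, if_neg (fun h => h1 (hiff.1 h).1)]; ring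
  refine (Finset.sum_le_sum step1).trans ?_
  rw [Finset.sum_comm]
  have step2 : ∀ U ∈ R.powerset, ∑ c ∈ Finset.Icc 1 M, h U * ∑ i, l i * (if d U * d (S i) ∣ c then trap A B (c / N) else 0) ≤
      N * (A ^ 2 - B ^ 2) / 2 * (∑ i, l i * ∏ p ∈ S i, (1 / (p:ℝ))) * (h U * (1 / (d U : ℝ))) +
      (A - B) * Fintype.card ι * (if (d U : ℝ) ≤ A * N then ∏ p ∈ U, betaf p else 0) := by
    intro U hU
    rw [Finset.mem_powerset] at hU
    have hdU : 0 < d U := Finset.prod_pos fun p hp => (hR p (hU hp)).pos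
    rw [← Finset.mul_sum]
    split_ifs with hc
    · have inner : ∑ c ∈ Finset.Icc 1 M, ∑ i, l i * (if d U * d (S i) ∣ c then trap A B (c / N) else 0) ≤
          N * (A ^ 2 - B ^ 2) / 2 * (∑ i, l i * ∏ p ∈ S i, (1 / (p:ℝ))) * (1 / (d U : ℝ)) + (A - B) * Fintype.card ι := by
        rw [Finset.sum_comm]
        have : ∀ i ∈ (Finset.univ : Finset ι), ∑ c ∈ Finset.Icc 1 M, l i * (if d U * d (S i) ∣ c then trap A B (c / N) else 0) ≤
            N * (A ^ 2 - B ^ 2) / 2 * (l i * ∏ p ∈ S i, (1 / (p:ℝ))) * (1 / (d U : ℝ)) + (A - B) := by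
          intro i _
          rw [← Finset.mul_sum]
          have hdS : 0 < d (S i) := Finset.prod_pos fun p hp => (hP p (hS i hp)).pos
          have t := trap_sum_dvd A B N hB hBA hN M hM (d U * d (S i)) (Nat.mul_pos hdU hdS)
          set X := ∑ c ∈ Finset.Icc 1 M, (if d U * d (S i) ∣ c then trap A B (c / N) else 0)
          have e : N * (A ^ 2 - B ^ 2) / 2 * (l i * ∏ p ∈ S i, (1 / (p:ℝ))) * (1 / (d U : ℝ)) = 
             l i * (N * (A ^ 2 - B ^ 2) / (2 * (d U * d (S i) : ℕ))) := by
            rw [show ∏ p ∈ S i, 1 / (p:ℝ) = 1 / (d (S i) : ℝ) by simp [hd]]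
            push_cast
            field_simp
          rw [e]
          have t2 : l i * (X - N * (A ^ 2 - B ^ 2) / (2 * (d U * d (S i) : ℕ))) ≤ A - B := by
            refine (le_abs_self _).trans ?_
            rw [abs_mul]
            calc _ ≤ 1 * (A - B) := mul_le_mul (hl i) t (abs_nonneg _) zero_le_one
              _ = _ := one_mul _
          linarith
        refine (Finset.sum_le_sum this).trans (le_of_eq ?_)
        rw [Finset.sum_add_distrib, ← Finset.sum_mul, ← Finset.mul_sum]
        simp; ring
      calc _ ≤ h U * _ := mul_le_mul_of_nonneg_left inner (hh0 U)
        _ ≤ _ := by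
          have hAB : 0 ≤ (A - B) * Fintype.card ι := mul_nonneg (by linarith) (by positivity)
          have := mul_le_mul_of_nonneg_left (hhβ U) hAB
          linarith
    · have hz : ∑ c ∈ Finset.Icc 1 M, ∑ i, l i * (if d U * d (S i) ∣ c then trap A B (c / N) else 0) = 0 := by
        apply Finset.sum_eq_zero
        intro c hc1
        apply Finset.sum_eq_zero
        intro i _
        split_ifs with hdv
        · rw [trap_zero hBA, mul_zero]
          rw [le_div_iff₀ hN]
          have : d U ≤ c := Nat.le_of_dvd (by rw [Finset.mem_Icc] at hc1; omega) ((dvd_mul_right _ _).trans hdv)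
          have : (d U : ℝ) ≤ c := by exact_mod_cast this
          linarith
        · simp
      rw [hz]
      have := hh0 U
      simp only [mul_zero, add_zero]
      positivity
  refine (Finset.sum_le_sum step2).trans (le_of_eq ?_)
  rw [Finset.sum_add_distrib, ← Finset.mul_sum, ← Finset.mul_sum, hsum1, mul_one]
  rfl


lemma sum_crt (A B : ℕ) (hA : 0 < A) (hB : 0 < B) (hAB : Nat.Coprime A B) (f h : ℕ → ℝ)
    (hf : ∀ k, f (k % A) = f k) (hh : ∀ k, h (k % B) = h k) :
    ∑ k ∈ Finset.range (A * B), f k * h k = (∑ k ∈ Finset.range A, f k) * ∑ k ∈ Finset.range B, h k := by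
  rw [Finset.sum_mul_sum, ← Finset.sum_product']
  refine Finset.sum_bij (fun k _ => (k % A, k % B)) ?_ ?_ ?_ ?_
  · intro k _
    simp [Nat.mod_lt _ hA, Nat.mod_lt _ hB]
  · intro a ha b hb hab
    simp only [Prod.mk.injEq] at hab
    rw [Finset.mem_range] at ha hb
    have : a ≡ b [MOD A * B] := (Nat.modEq_and_modEq_iff_modEq_mul hAB).1 ⟨hab.1, hab.2⟩
    exact Nat.ModEq.eq_of_lt_of_lt this ha hb
  · rintro ⟨a, b⟩ hab
    simp only [Finset.mem_product, Finset.mem_range] at hab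
    have h1 := (Nat.chineseRemainder hAB a b).2
    refine ⟨Nat.chineseRemainder hAB a b, Finset.mem_range.2 (Nat.chineseRemainder_lt_mul hAB a b hA.ne' hB.ne'), ?_⟩
    have e1 : (Nat.chineseRemainder hAB a b : ℕ) % A = a % A := h1.1
    have e2 : (Nat.chineseRemainder hAB a b : ℕ) % B = b % B := h1.2
    rw [e1, e2, Nat.mod_eq_of_lt hab.1, Nat.mod_eq_of_lt hab.2]
  · intro k _
    simp only [hf, hh]

lemma sum_crt_prod (S : Finset ℕ) (hS : ∀ p ∈ S, p.Prime) (f : ℕ → ℕ → ℝ) (hf : ∀ p k, f p (k % p) = f p k) :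
    ∑ k ∈ Finset.range (∏ p ∈ S, p), ∏ p ∈ S, f p k = ∏ p ∈ S, ∑ k ∈ Finset.range p, f p k := by
  induction S using Finset.induction_on with
  | empty => simp
  | insert q S hq ih =>
    have hS' : ∀ p ∈ S, p.Prime := fun p hp => hS p (Finset.mem_insert_of_mem hp)
    have hqp := hS q (Finset.mem_insert_self _ _)
    simp only [Finset.prod_insert hq]
    rw [sum_crt q (∏ p ∈ S, p) hqp.pos (Finset.prod_pos fun p hp => (hS' p hp).pos) ?_ (f q) (fun k => ∏ p ∈ S, f p k) (hf q) ?_, ih hS']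
    · apply Nat.Coprime.prod_right
      intro p hp
      rw [Nat.coprime_primes hqp (hS' p hp)]
      rintro rfl; exact hq hp
    · intro k
      refine Finset.prod_congr rfl fun p hp => ?_
      rw [← hf p (k % _), Nat.mod_mod_of_dvd _ (Finset.dvd_prod_of_mem (fun p => p) hp), hf]

lemma sum_periodic (M t : ℕ) (F : ℕ → ℝ) (hF : ∀ k, F (k % M) = F k) :
    ∑ k ∈ Finset.range (M * t), F k = t * ∑ k ∈ Finset.range M, F k := by
  induction t with
  | zero => simp
  | succ t ih =>
    rw [Nat.mul_succ, Finset.sum_range_add, ih]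
    have : ∑ x ∈ Finset.range M, F (M * t + x) = ∑ x ∈ Finset.range M, F x := by
      refine Finset.sum_congr rfl fun x _ => ?_
      rw [← hF, Nat.mul_add_mod, hF]
    rw [this]; push_cast; ring

lemma sum_crt_g (g : ℕ) (hg : 0 < g) (f : ℕ → ℕ → ℝ) (hf : ∀ p k, f p (k % p) = f p k) :
    ∑ k ∈ Finset.range g, ∏ p ∈ g.primeFactors, f p k = g * ∏ p ∈ g.primeFactors, ((∑ k ∈ Finset.range p, f p k) / p) := by
  obtain ⟨t, ht⟩ := Nat.prod_primeFactors_dvd g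
  have hpr : ∀ p ∈ g.primeFactors, p.Prime := fun p hp => Nat.prime_of_mem_primeFactors hp
  have h1 := sum_periodic (∏ p ∈ g.primeFactors, p) t (fun k => ∏ p ∈ g.primeFactors, f p k) (by
    intro k
    refine Finset.prod_congr rfl fun p hp => ?_
    rw [← hf p (k % _), Nat.mod_mod_of_dvd _ (Finset.dvd_prod_of_mem (fun p => p) hp), hf])
  rw [← ht, sum_crt_prod _ hpr f hf] at h1
  rw [h1, Finset.prod_div_distrib]
  have h2 : (g:ℝ) = (∏ p ∈ g.primeFactors, (p:ℝ)) * t := by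
    have h := congrArg (Nat.cast (R := ℝ)) ht
    push_cast at h
    exact h
  have h3 : (∏ p ∈ g.primeFactors, (p:ℝ)) ≠ 0 := Finset.prod_ne_zero_iff.2 fun p hp => by
    exact_mod_cast (hpr p hp).ne_zero
  generalize (∏ p ∈ g.primeFactors, (p:ℝ)) = Pr at h2 h3
  generalize (∏ p ∈ g.primeFactors, ∑ k ∈ Finset.range p, f p k) = Y
  rw [h2]; field_simp

lemma exists_root (p : ℕ) (hp : p.Prime) (w v : ℤ) (hv : ¬ (p:ℤ) ∣ v) : ∃ j < p, (p:ℤ) ∣ w + j * v := by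
  haveI := Fact.mk hp
  have hv' : (v : ZMod p) ≠ 0 := by rwa [Ne, ZMod.intCast_zmod_eq_zero_iff_dvd]
  refine ⟨(-(w : ZMod p) * (v : ZMod p)⁻¹).val, ZMod.val_lt _, ?_⟩
  rw [← ZMod.intCast_zmod_eq_zero_iff_dvd]
  push_cast
  rw [ZMod.natCast_zmod_val, mul_assoc, inv_mul_cancel₀ hv']
  ring

open Classical in
lemma local_count (p : ℕ) (hp : p.Prime) (a b v w : ℤ) (hvw : ¬ ((p:ℤ) ∣ v ∧ (p:ℤ) ∣ w)) :
    (∑ j ∈ Finset.range p, if ((p:ℤ) ∣ a + j * v ∨ (p:ℤ) ∣ b + j * w) then (0:ℝ) else 1) ≤ p - 1 ∧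
    (¬ (p:ℤ) ∣ v → ¬ (p:ℤ) ∣ w → ¬ (p:ℤ) ∣ a * w - b * v →
    (∑ j ∈ Finset.range p, if ((p:ℤ) ∣ a + j * v ∨ (p:ℤ) ∣ b + j * w) then (0:ℝ) else 1) ≤ p - 2) := by
  have key : ∀ T : Finset ℕ, T ⊆ Finset.range p → (∀ j ∈ T, ((p:ℤ) ∣ a + j * v ∨ (p:ℤ) ∣ b + j * w)) →
     (∑ j ∈ Finset.range p, if ((p:ℤ) ∣ a + j * v ∨ (p:ℤ) ∣ b + j * w) then (0:ℝ) else 1) ≤ p - T.card := by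
    intro T hT h
    calc _ ≤ ∑ j ∈ Finset.range p, (1 - if j ∈ T then (1:ℝ) else 0) := by
          apply Finset.sum_le_sum
          intro j hj
          by_cases hjT : j ∈ T
          · simp [h j hjT, hjT]
          · simp only [hjT, if_false]; split_ifs <;> norm_num
      _ = _ := by
        rw [Finset.sum_sub_distrib]
        simp [Finset.inter_eq_right.2 hT]
  constructor
  · have : ∃ j < p, ((p:ℤ) ∣ a + j * v ∨ (p:ℤ) ∣ b + j * w) := by
      by_cases hv : (p:ℤ) ∣ v
      · obtain ⟨j, hj, h⟩ := exists_root p hp b w (fun hw => hvw ⟨hv, hw⟩)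
        exact ⟨j, hj, Or.inr h⟩
      · obtain ⟨j, hj, h⟩ := exists_root p hp a v hv
        exact ⟨j, hj, Or.inl h⟩
    obtain ⟨j, hj, h⟩ := this
    have := key {j} (by simpa using hj) (by simpa using h)
    simpa using this
  · intro hv hw hc
    obtain ⟨j, hj, h⟩ := exists_root p hp a v hv
    obtain ⟨k, hk, h'⟩ := exists_root p hp b w hw
    have hjk : j ≠ k := by
      rintro rfl
      apply hc
      have := dvd_sub (h.mul_right w) (h'.mul_right v)
      ring_nf at this ⊢
      exact this
    have := key {j, k} (by intro x hx; simp at hx; rcases hx with rfl | rfl <;> simpa) (by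
      intro x hx; simp at hx; rcases hx with rfl | rfl
      · exact Or.inl h
      · exact Or.inr h')
    rw [Finset.card_pair hjk] at this
    exact_mod_cast this

open Classical in
noncomputable def Fib (n m : ℕ) (c : ℤ) : Finset (ℕ × ℕ) :=
  ((Finset.range (n+1) ×ˢ Finset.range (m+1)).filter (fun x => Nat.Coprime x.1 n ∧ Nat.Coprime x.2 m)).filter
    (fun x => (x.1 : ℤ) * ((m / Nat.gcd n m : ℕ) : ℤ) - (x.2 : ℤ) * ((n / Nat.gcd n m : ℕ):ℤ) = c)

lemma Fib_mem (n m : ℕ) (c : ℤ) (x : ℕ × ℕ) : x ∈ Fib n m c ↔ x.1 ≤ n ∧ x.2 ≤ m ∧ Nat.Coprime x.1 n ∧ Nat.Coprime x.2 m ∧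
    (x.1 : ℤ) * ((m / Nat.gcd n m : ℕ) : ℤ) - (x.2 : ℤ) * ((n / Nat.gcd n m : ℕ):ℤ) = c := by
  unfold Fib
  simp [Nat.lt_succ_iff]
  tauto

lemma Fib_empty (n m : ℕ) (hn : 0 < n) (c : ℤ) (p : ℕ) (hp : p.Prime)
    (hpQ : p ∣ (n / Nat.gcd n m) * (m / Nat.gcd n m)) (hpc : (p:ℤ) ∣ c) : Fib n m c = ∅ := by
  apply Finset.eq_empty_of_forall_notMem
  rintro ⟨a, b⟩ hx
  rw [Fib_mem] at hx
  obtain ⟨_, _, h1, h2, h3⟩ := hx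
  simp only at h1 h2 h3
  have hcop : Nat.Coprime (n / Nat.gcd n m) (m / Nat.gcd n m) := Nat.coprime_div_gcd_div_gcd (Nat.gcd_pos_of_pos_left _ hn)
  set n' := n / Nat.gcd n m with hn'
  set m' := m / Nat.gcd n m with hm'
  have hnn : n' ∣ n := Nat.div_dvd_of_dvd (Nat.gcd_dvd_left n m)
  have hmm : m' ∣ m := Nat.div_dvd_of_dvd (Nat.gcd_dvd_right n m)
  rcases (Nat.Prime.dvd_mul hp).1 hpQ with h | h
  · have hd : (p:ℤ) ∣ (a:ℤ) * m' := by
      have : (a:ℤ) * m' = c + b * n' := by linarith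
      rw [this]
      exact dvd_add hpc ((Int.natCast_dvd_natCast.2 h).mul_left _)
    have hd' : p ∣ a * m' := by exact_mod_cast hd
    rcases (Nat.Prime.dvd_mul hp).1 hd' with h4 | h4
    · exact Nat.not_coprime_of_dvd_of_dvd hp.one_lt h4 (h.trans hnn) h1
    · exact Nat.not_coprime_of_dvd_of_dvd hp.one_lt h h4 hcop
  · have hd : (p:ℤ) ∣ (b:ℤ) * n' := by
      have : (b:ℤ) * n' = a * m' - c := by linarith
      rw [this]
      exact dvd_sub ((Int.natCast_dvd_natCast.2 h).mul_left _) hpc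
    have hd' : p ∣ b * n' := by exact_mod_cast hd
    rcases (Nat.Prime.dvd_mul hp).1 hd' with h4 | h4
    · exact Nat.not_coprime_of_dvd_of_dvd hp.one_lt h4 (h.trans hmm) h2
    · exact Nat.not_coprime_of_dvd_of_dvd hp.one_lt h4 h hcop

open Classical in
lemma Fib_card_aux (n m : ℕ) (hn : 0 < n) (hm : 0 < m) (hnm : n ≠ m) (c : ℤ) (a0 b0 : ℕ) (h0 : (a0, b0) ∈ Fib n m c) :
    (Fib n m c).card ≤ ((Finset.range (Nat.gcd n m)).filter (fun j : ℕ => ∀ p ∈ (Nat.gcd n m).primeFactors,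
      ¬ ((p:ℤ) ∣ a0 + j * ((n / Nat.gcd n m : ℕ):ℤ) ∨ (p:ℤ) ∣ b0 + j * ((m / Nat.gcd n m : ℕ):ℤ)))).card := by
  have hg : 0 < Nat.gcd n m := Nat.gcd_pos_of_pos_left _ hn
  have hcop : Nat.Coprime (n / Nat.gcd n m) (m / Nat.gcd n m) := Nat.coprime_div_gcd_div_gcd hg
  have en : n / Nat.gcd n m * Nat.gcd n m = n := Nat.div_mul_cancel (Nat.gcd_dvd_left n m)
  have em : m / Nat.gcd n m * Nat.gcd n m = m := Nat.div_mul_cancel (Nat.gcd_dvd_right n m)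
  have hmem := Fib_mem n m c
  set g := Nat.gcd n m with hgdef
  set n' := n / g with hn'
  set m' := m / g with hm'
  have hn'0 : 0 < n' := Nat.pos_of_ne_zero (by rintro h; rw [h] at en; omega)
  have hm'0 : 0 < m' := Nat.pos_of_ne_zero (by rintro h; rw [h] at em; omega)
  rw [hmem] at h0
  obtain ⟨_, _, h01, h02, h03⟩ := h0
  simp only at h01 h02 h03
  have hk : ∀ x ∈ Fib n m c, ∃ k : ℤ, (x.1 : ℤ) = a0 + k * n' ∧ (x.2 : ℤ) = b0 + k * m' := by
    intro x hx
    rw [hmem] at hx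
    obtain ⟨_, _, _, _, h3⟩ := hx
    have e : ((x.1 : ℤ) - a0) * m' = ((x.2:ℤ) - b0) * n' := by linarith
    have hd : (n' : ℤ) ∣ (x.1 : ℤ) - a0 := by
      have h1 : (n':ℤ) ∣ ((x.1 : ℤ) - a0) * m' := by rw [e]; exact dvd_mul_left _ _
      exact (Nat.isCoprime_iff_coprime.2 hcop).dvd_of_dvd_mul_right h1
    obtain ⟨k, hk⟩ := hd
    refine ⟨k, by linarith, ?_⟩
    rw [hk] at e
    have hn'z : (n':ℤ) ≠ 0 := by exact_mod_cast hn'0.ne'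
    have : (x.2:ℤ) - b0 = k * m' := by
      apply mul_right_cancel₀ hn'z
      rw [← e]; ring
    linarith
  choose! K hK using hk
  have hgz : (g:ℤ) ≠ 0 := by exact_mod_cast hg.ne'
  have hmodnn : ∀ k : ℤ, 0 ≤ k % (g:ℤ) := fun k => Int.emod_nonneg k hgz
  refine Finset.card_le_card_of_injOn (fun x => (K x % (g:ℤ)).toNat) ?_ ?_
  · intro x hx
    simp only [Finset.mem_coe] at hx
    obtain ⟨hK1, hK2⟩ := hK x hx
    rw [hmem] at hx
    obtain ⟨_, _, hx1, hx2, _⟩ := hx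
    simp only [Finset.mem_coe, Finset.mem_filter, Finset.mem_range]
    constructor
    · have := Int.emod_lt_of_pos (K x) (by exact_mod_cast hg : (0:ℤ) < g)
      have := hmodnn (K x)
      omega
    · intro p hp
      have hpp := Nat.prime_of_mem_primeFactors hp
      have hpg := Nat.dvd_of_mem_primeFactors hp
      rw [Int.toNat_of_nonneg (hmodnn _)]
      have hdiv : (p:ℤ) ∣ K x % g - K x := by
        have : (g:ℤ) ∣ K x % g - K x := (Int.mod_modEq (K x) g).symm.dvd
        exact (Int.natCast_dvd_natCast.2 hpg).trans this
      rintro (h | h)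
      · have : (p:ℤ) ∣ (x.1 : ℤ) := by
          rw [hK1]
          have e : (a0:ℤ) + K x * n' = (a0 + K x % g * n') - (K x % g - K x) * n' := by ring
          rw [e]
          exact dvd_sub h (hdiv.mul_right _)
        have hpa : p ∣ x.1 := by exact_mod_cast this
        exact Nat.not_coprime_of_dvd_of_dvd hpp.one_lt hpa (hpg.trans (Nat.gcd_dvd_left n m)) hx1
      · have : (p:ℤ) ∣ (x.2 : ℤ) := by
          rw [hK2]
          have e : (b0:ℤ) + K x * m' = (b0 + K x % g * m') - (K x % g - K x) * m' := by ring
          rw [e]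
          exact dvd_sub h (hdiv.mul_right _)
        have hpa : p ∣ x.2 := by exact_mod_cast this
        exact Nat.not_coprime_of_dvd_of_dvd hpp.one_lt hpa (hpg.trans (Nat.gcd_dvd_right n m)) hx2
  · intro x hx y hy hxy
    simp only [Finset.mem_coe] at hx hy
    obtain ⟨x1, x2⟩ := hK x hx
    obtain ⟨y1, y2⟩ := hK y hy
    rw [hmem] at hx hy
    obtain ⟨hx1, hx2, hx3, hx4, _⟩ := hx
    obtain ⟨hy1, hy2, hy3, hy4, _⟩ := hy
    have hmod : K x % (g:ℤ) = K y % (g:ℤ) := by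
      have h1 := hmodnn (K x)
      have h2 := hmodnn (K y)
      simp only at hxy
      omega
    obtain ⟨t, ht⟩ := (Int.ModEq.dvd hmod : (g:ℤ) ∣ K y - K x)
    have enz : (n':ℤ) * g = n := by exact_mod_cast en
    have emz : (m':ℤ) * g = m := by exact_mod_cast em
    have d1 : (y.1:ℤ) - x.1 = t * n := by
      rw [x1, y1, ← enz]; linear_combination (n':ℤ) * ht
    have d2 : (y.2:ℤ) - x.2 = t * m := by
      rw [x2, y2, ← emz]; linear_combination (m':ℤ) * ht
    have hnz : (0:ℤ) < n := by exact_mod_cast hn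
    have hmz : (0:ℤ) < m := by exact_mod_cast hm
    have bx1 : (x.1:ℤ) ≤ n := by exact_mod_cast hx1
    have bx2 : (x.2:ℤ) ≤ m := by exact_mod_cast hx2
    have by1 : (y.1:ℤ) ≤ n := by exact_mod_cast hy1
    have by2 : (y.2:ℤ) ≤ m := by exact_mod_cast hy2
    have zx1 : (0:ℤ) ≤ x.1 := by positivity
    have zx2 : (0:ℤ) ≤ x.2 := by positivity
    have zy1 : (0:ℤ) ≤ y.1 := by positivity
    have zy2 : (0:ℤ) ≤ y.2 := by positivity
    rcases lt_trichotomy t 0 with h | h | h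
    · exfalso
      have w1 : t * n ≤ (-1) * n := mul_le_mul_of_nonneg_right (by omega) hnz.le
      have w2 : t * m ≤ (-1) * m := mul_le_mul_of_nonneg_right (by omega) hmz.le
      have q1 : (y.1:ℤ) = 0 := by linarith
      have q2 : (y.2:ℤ) = 0 := by linarith
      have q1' : y.1 = 0 := by exact_mod_cast q1
      have q2' : y.2 = 0 := by exact_mod_cast q2
      rw [q1'] at hy3; rw [q2'] at hy4
      simp at hy3 hy4
      omega
    · subst h
      simp at d1 d2
      apply Prod.ext <;> omega
    · exfalso
      have w1 : 1 * (n:ℤ) ≤ t * n := mul_le_mul_of_nonneg_right (by omega) hnz.le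
      have w2 : 1 * (m:ℤ) ≤ t * m := mul_le_mul_of_nonneg_right (by omega) hmz.le
      have q1 : (x.1:ℤ) = 0 := by linarith
      have q2 : (x.2:ℤ) = 0 := by linarith
      have q1' : x.1 = 0 := by exact_mod_cast q1
      have q2' : x.2 = 0 := by exact_mod_cast q2
      rw [q1'] at hx3; rw [q2'] at hx4
      simp at hx3 hx4
      omega

lemma totient_real (n : ℕ) : (Nat.totient n : ℝ) = n * ∏ p ∈ n.primeFactors, (1 - 1 / (p:ℝ)) := by
  have h := congrArg (Rat.cast (K := ℝ)) (Nat.totient_eq_mul_prod_factors n)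
  push_cast at h
  simpa [one_div] using h

noncomputable def kap (n m : ℕ) : ℝ := (Nat.totient n : ℝ) * Nat.totient m /
  (((n:ℝ) * m / Nat.gcd n m) * ∏ p ∈ ((n / Nat.gcd n m) * (m / Nat.gcd n m)).primeFactors, (1 - 1 / (p:ℝ)))

lemma kap_eq (n m : ℕ) (hn : 0 < n) (hm : 0 < m) : kap n m = (Nat.gcd n m : ℝ) *
    ((∏ p ∈ (Nat.gcd n m).primeFactors \ ((n / Nat.gcd n m) * (m / Nat.gcd n m)).primeFactors, (1 - 1 / (p:ℝ)) ^ 2) *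
    ∏ p ∈ (Nat.gcd n m).primeFactors ∩ ((n / Nat.gcd n m) * (m / Nat.gcd n m)).primeFactors, (1 - 1 / (p:ℝ))) := by
  have hg : 0 < Nat.gcd n m := Nat.gcd_pos_of_pos_left _ hn
  have en : n / Nat.gcd n m * Nat.gcd n m = n := Nat.div_mul_cancel (Nat.gcd_dvd_left n m)
  have em : m / Nat.gcd n m * Nat.gcd n m = m := Nat.div_mul_cancel (Nat.gcd_dvd_right n m)
  have hint : n.primeFactors ∩ m.primeFactors = (Nat.gcd n m).primeFactors :=
    (Nat.primeFactors_gcd hn.ne' hm.ne').symm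
  unfold kap
  rw [totient_real, totient_real]
  set g := Nat.gcd n m with hgdef
  have hn'0 : n / g ≠ 0 := by intro h; rw [h] at en; omega
  have hm'0 : m / g ≠ 0 := by intro h; rw [h] at em; omega
  set Q := (n / g) * (m / g) with hQ
  have hun : n.primeFactors ∪ m.primeFactors = (g.primeFactors \ Q.primeFactors) ∪ Q.primeFactors := by
    have e1 : n.primeFactors = (n/g).primeFactors ∪ g.primeFactors := by
      conv_lhs => rw [← en]
      exact Nat.primeFactors_mul hn'0 hg.ne'
    have e2 : m.primeFactors = (m/g).primeFactors ∪ g.primeFactors := by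
      conv_lhs => rw [← em]
      exact Nat.primeFactors_mul hm'0 hg.ne'
    have e3 : Q.primeFactors = (n/g).primeFactors ∪ (m/g).primeFactors := Nat.primeFactors_mul hn'0 hm'0
    rw [e1, e2, Finset.sdiff_union_self_eq_union, e3]
    ext p; simp only [Finset.mem_union]; tauto
  have hprod := Finset.prod_union_inter (s₁ := n.primeFactors) (s₂ := m.primeFactors) (f := fun p : ℕ => 1 - 1 / (p:ℝ))
  rw [hun, hint, Finset.prod_union Finset.sdiff_disjoint] at hprod
  have hg2 := Finset.prod_inter_mul_prod_sdiff g.primeFactors Q.primeFactors (fun p : ℕ => 1 - 1 / (p:ℝ))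
  have hpos : ∀ p ∈ Q.primeFactors, 1 - 1 / (p:ℝ) ≠ 0 := by
    intro p hp
    have h2 : (2:ℝ) ≤ p := by exact_mod_cast (Nat.prime_of_mem_primeFactors hp).two_le
    have : 1 / (p:ℝ) ≤ 1 / 2 := one_div_le_one_div_of_le (by norm_num) h2
    linarith
  have hV := Finset.prod_ne_zero_iff.2 hpos
  rw [← hg2] at hprod
  rw [Finset.prod_pow]
  have h1 : (n:ℝ) ≠ 0 := by exact_mod_cast hn.ne'
  have h2 : (m:ℝ) ≠ 0 := by exact_mod_cast hm.ne'
  have h3 : (g:ℝ) ≠ 0 := by exact_mod_cast hg.ne'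
  rw [div_eq_iff (by positivity)]
  calc _ = (n:ℝ) * m * ((∏ p ∈ n.primeFactors, (1 - 1 / (p:ℝ))) * ∏ p ∈ m.primeFactors, (1 - 1 / (p:ℝ))) := by ring
    _ = _ := by
      rw [← hprod]; field_simp

lemma fR_nonneg (p : ℕ) (hp : p.Prime) (c : ℕ) : 0 ≤ betaf p * (if p ∣ c then (1:ℝ) else 0) + alphaf p := by
  have h2 : (2:ℝ) ≤ p := by exact_mod_cast hp.two_le
  have h3 : (1:ℝ) ≤ ((p:ℝ) - 1) ^ 2 := by nlinarith
  have h4 : 1 / ((p:ℝ) - 1) ^ 2 ≤ 1 := by rw [div_le_one (by linarith)]; exact h3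
  unfold betaf alphaf
  have : 0 ≤ (p:ℝ) / ((p:ℝ) - 1) ^ 2 * (if p ∣ c then (1:ℝ) else 0) := by
    apply mul_nonneg (by positivity); split_ifs <;> norm_num
  linarith

lemma Fib_card (n m : ℕ) (hn : 0 < n) (hm : 0 < m) (hnm : n ≠ m) (c : ℤ) :
    ((Fib n m c).card : ℝ) ≤ kap n m *
      (∏ p ∈ ((n / Nat.gcd n m) * (m / Nat.gcd n m)).primeFactors, (1 - if p ∣ c.natAbs then (1:ℝ) else 0)) *
      ∏ p ∈ (Nat.gcd n m).primeFactors \ ((n / Nat.gcd n m) * (m / Nat.gcd n m)).primeFactors,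
        (betaf p * (if p ∣ c.natAbs then (1:ℝ) else 0) + alphaf p) := by
  have hg : 0 < Nat.gcd n m := Nat.gcd_pos_of_pos_left _ hn
  have hcop : Nat.Coprime (n / Nat.gcd n m) (m / Nat.gcd n m) := Nat.coprime_div_gcd_div_gcd hg
  have en : n / Nat.gcd n m * Nat.gcd n m = n := Nat.div_mul_cancel (Nat.gcd_dvd_left n m)
  have em : m / Nat.gcd n m * Nat.gcd n m = m := Nat.div_mul_cancel (Nat.gcd_dvd_right n m)
  have hemp := Fib_empty n m hn c
  have haux := Fib_card_aux n m hn hm hnm c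
  have hmem := Fib_mem n m c
  rw [kap_eq n m hn hm]
  set g := Nat.gcd n m with hgdef
  set n' := n / g with hn'
  set m' := m / g with hm'
  have hn'0 : n' ≠ 0 := by intro h; rw [h] at en; omega
  have hm'0 : m' ≠ 0 := by intro h; rw [h] at em; omega
  set Q := n' * m' with hQ
  have hQ0 : Q ≠ 0 := mul_ne_zero hn'0 hm'0
  have hfac : ∀ p : ℕ, p.Prime → 0 < 1 - 1 / (p:ℝ) := by
    intro p hp
    have h2 : (2:ℝ) ≤ p := by exact_mod_cast hp.two_le
    have : 1 / (p:ℝ) ≤ 1 / 2 := one_div_le_one_div_of_le (by norm_num) h2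
    linarith
  have hRHS : 0 ≤ (g : ℝ) *
      ((∏ p ∈ g.primeFactors \ Q.primeFactors, (1 - 1 / (p:ℝ)) ^ 2) *
        ∏ p ∈ g.primeFactors ∩ Q.primeFactors, (1 - 1 / (p:ℝ))) *
      (∏ p ∈ Q.primeFactors, (1 - if p ∣ c.natAbs then (1:ℝ) else 0)) *
      ∏ p ∈ g.primeFactors \ Q.primeFactors, (betaf p * (if p ∣ c.natAbs then (1:ℝ) else 0) + alphaf p) := by
    refine mul_nonneg (mul_nonneg (mul_nonneg (by positivity) (mul_nonneg ?_ ?_)) ?_) ?_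
    · exact Finset.prod_nonneg fun p _ => sq_nonneg _
    · exact Finset.prod_nonneg fun p hp => (hfac p (Nat.prime_of_mem_primeFactors (Finset.mem_inter.1 hp).1)).le
    · exact Finset.prod_nonneg fun p _ => by split_ifs <;> norm_num
    · exact Finset.prod_nonneg fun p hp => fR_nonneg p (Nat.prime_of_mem_primeFactors (Finset.mem_sdiff.1 hp).1) _
  rcases (Fib n m c).eq_empty_or_nonempty with h | ⟨⟨a0, b0⟩, h0⟩
  · rw [h]; simpa using hRHS
  have hQc : ∀ p ∈ Q.primeFactors, ¬ p ∣ c.natAbs := by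
    intro p hp hpc
    have := hemp p (Nat.prime_of_mem_primeFactors hp) (Nat.dvd_of_mem_primeFactors hp) (Int.natCast_dvd.2 hpc)
    rw [this] at h0; simp at h0
  have e1 : (∏ p ∈ Q.primeFactors, (1 - if p ∣ c.natAbs then (1:ℝ) else 0)) = 1 := by
    apply Finset.prod_eq_one
    intro p hp; simp [hQc p hp]
  rw [e1, mul_one]
  classical
  let f : ℕ → ℕ → ℝ := fun p j => if ((p:ℤ) ∣ a0 + j * (n':ℤ) ∨ (p:ℤ) ∣ b0 + j * (m':ℤ)) then (0:ℝ) else 1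
  have hf : ∀ p k, f p (k % p) = f p k := by
    intro p k
    have hd : (p:ℤ) ∣ ((k % p : ℕ):ℤ) - k := by
      push_cast; exact (Int.mod_modEq (k:ℤ) p).symm.dvd
    have q : ∀ x y : ℤ, (p:ℤ) ∣ x + ((k % p : ℕ):ℤ) * y ↔ (p:ℤ) ∣ x + (k:ℤ) * y := by
      intro x y
      have e : x + ((k % p : ℕ):ℤ) * y = (x + k * y) + (((k % p : ℕ):ℤ) - k) * y := by ring
      rw [e]
      exact dvd_add_left (hd.mul_right y)
    simp only [f, q]
  have hcard := haux a0 b0 h0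
  have hc2 : ((Fib n m c).card : ℝ) ≤ ∑ j ∈ Finset.range g, ∏ p ∈ g.primeFactors, f p j := by
    refine le_trans (Nat.cast_le.2 hcard) ?_
    rw [Finset.card_filter, Nat.cast_sum]
    apply Finset.sum_le_sum
    intro j _
    split_ifs with h
    · rw [Finset.prod_eq_one]
      · simp
      · intro p hp
        have := h p hp
        simp only [f]
        rw [if_neg this]
    · simp only [Nat.cast_zero]
      exact Finset.prod_nonneg fun p _ => by simp only [f]; split_ifs <;> norm_num
  refine hc2.trans ?_
  rw [sum_crt_g g hg f hf, ← Finset.prod_inter_mul_prod_sdiff g.primeFactors Q.primeFactors, mul_assoc]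
  apply mul_le_mul_of_nonneg_left _ (by positivity)
  rw [mul_comm, mul_right_comm, ← Finset.prod_mul_distrib]
  have hfn : ∀ p, 0 ≤ (∑ k ∈ Finset.range p, f p k) / (p:ℝ) := fun p => by
    refine div_nonneg (Finset.sum_nonneg fun j _ => ?_) (Nat.cast_nonneg p)
    simp only [f]; split_ifs <;> norm_num
  have hc : (a0:ℤ) * m' - b0 * n' = c := ((hmem (a0, b0)).1 h0).2.2.2.2
  have hndvd : ∀ p : ℕ, p.Prime → ¬ ((p:ℤ) ∣ (n':ℤ) ∧ (p:ℤ) ∣ (m':ℤ)) := by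
    rintro p hp ⟨h1, h2⟩
    exact Nat.not_coprime_of_dvd_of_dvd hp.one_lt (Int.natCast_dvd_natCast.1 h1) (Int.natCast_dvd_natCast.1 h2) hcop
  apply mul_le_mul
  · apply Finset.prod_le_prod (fun p _ => hfn p)
    intro p hp
    obtain ⟨hp1, hp2⟩ := Finset.mem_sdiff.1 hp
    have hpp := Nat.prime_of_mem_primeFactors hp1
    have hp0 : (2:ℝ) ≤ p := by exact_mod_cast hpp.two_le
    have hp3 : (p:ℝ) - 1 ≠ 0 := by linarith
    have hp4 : (p:ℝ) ≠ 0 := by linarith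
    obtain ⟨l1, l2⟩ := local_count p hpp a0 b0 n' m' (hndvd p hpp)
    rw [div_le_iff₀ (by linarith)]
    by_cases hpc : p ∣ c.natAbs
    · refine l1.trans (le_of_eq ?_)
      rw [if_pos hpc]
      unfold betaf alphaf
      field_simp
      ring
    · have hpQ : ¬ p ∣ Q := fun h => hp2 (Nat.mem_primeFactors.2 ⟨hpp, h, hQ0⟩)
      have t1 : ¬ (p:ℤ) ∣ (n':ℤ) := fun h => hpQ ((Int.natCast_dvd_natCast.1 h).mul_right _)
      have t2 : ¬ (p:ℤ) ∣ (m':ℤ) := fun h => hpQ ((Int.natCast_dvd_natCast.1 h).mul_left _)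
      have t3 : ¬ (p:ℤ) ∣ (a0:ℤ) * m' - b0 * n' := by rw [hc]; exact fun h => hpc (Int.natCast_dvd.1 h)
      refine (l2 t1 t2 t3).trans (le_of_eq ?_)
      rw [if_neg hpc]
      unfold betaf alphaf
      field_simp
      ring
  · apply Finset.prod_le_prod (fun p _ => hfn p)
    intro p hp
    have hpp := Nat.prime_of_mem_primeFactors (Finset.mem_inter.1 hp).1
    have hp0 : (2:ℝ) ≤ p := by exact_mod_cast hpp.two_le
    obtain ⟨l1, _⟩ := local_count p hpp a0 b0 n' m' (hndvd p hpp)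
    rw [div_le_iff₀ (by linarith)]
    refine l1.trans (le_of_eq ?_)
    field_simp
  · exact Finset.prod_nonneg fun p _ => hfn p
  · refine Finset.prod_nonneg fun p hp => mul_nonneg (sq_nonneg _) (fR_nonneg p (Nat.prime_of_mem_primeFactors (Finset.mem_sdiff.1 hp).1) _)

lemma DSset_lower (ψ : ℕ → ℝ) (n : ℕ) (hn : 0 < n) (h0 : 0 ≤ ψ n) (h1 : ψ n ≤ 1/2) :
    2 * (Nat.totient n : ℝ) * ψ n / n ≤ (volume (DSset ψ n)).toReal := by
  have hfin : volume (DSset ψ n) ≠ ⊤ := by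
    refine ne_top_of_le_ne_top ?_ (measure_mono (Set.inter_subset_right : DSset ψ n ⊆ Set.Icc 0 1))
    simp
  rcases Nat.lt_or_ge 1 n with hn1 | hn1
  · have hnr : (0:ℝ) < n := by exact_mod_cast hn
    let I : ℕ → Set ℝ := fun a => Set.Ioo ((a : ℝ) / n - ψ n / n) ((a : ℝ) / n + ψ n / n)
    let C := (Finset.range n).filter (fun a => n.Coprime a)
    have hsub : (⋃ a ∈ C, I a) ⊆ DSset ψ n := by
      intro x hx
      simp only [Set.mem_iUnion] at hx
      obtain ⟨a, ha, hx⟩ := hx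
      simp only [C, Finset.mem_filter, Finset.mem_range] at ha
      simp only [I, Set.mem_Ioo, ← sub_div, ← add_div] at hx
      rw [div_lt_iff₀ hnr, lt_div_iff₀ hnr] at hx
      have ha1 : 1 ≤ a := by
        rcases Nat.eq_zero_or_pos a with h | h
        · rw [h] at ha; have := ha.2; simp at this; omega
        · exact h
      have ha1r : (1:ℝ) ≤ a := by exact_mod_cast ha1
      have ha2r : (a:ℝ) + 1 ≤ n := by exact_mod_cast ha.1
      refine ⟨?_, ?_, ?_⟩
      · simp only [Set.mem_iUnion]
        refine ⟨a, ⟨ha.1.le, ha.2.symm⟩, ?_⟩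
        rw [Set.mem_Icc, ← sub_div, ← add_div, div_le_iff₀ hnr, le_div_iff₀ hnr]
        exact ⟨hx.1.le, hx.2.le⟩
      · by_contra h
        have := mul_nonpos_of_nonpos_of_nonneg (not_le.1 h).le hnr.le
        linarith
      · by_contra h
        have := mul_lt_mul_of_pos_right (not_le.1 h) hnr
        linarith
    have hdis : (C : Set ℕ).PairwiseDisjoint I := by
      have key : ∀ a b : ℕ, a < b → Disjoint (I a) (I b) := by
        intro a b hab
        rw [Set.disjoint_left]
        intro x hx hy
        simp only [I, Set.mem_Ioo, ← sub_div, ← add_div] at hx hy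
        rw [div_lt_iff₀ hnr, lt_div_iff₀ hnr] at hx hy
        have : (a:ℝ) + 1 ≤ b := by exact_mod_cast hab
        linarith
      intro a _ b _ hab
      rcases lt_or_gt_of_ne hab with h | h
      · exact key a b h
      · exact (key b a h).symm
    have hvol : volume (⋃ a ∈ C, I a) = ENNReal.ofReal (2 * (Nat.totient n : ℝ) * ψ n / n) := by
      rw [measure_biUnion_finset hdis (fun a _ => measurableSet_Ioo)]
      simp only [I, Real.volume_Ioo]
      rw [← ENNReal.ofReal_sum_of_nonneg]
      · congr 1
        rw [Nat.totient_eq_card_coprime]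
        have : ∀ a : ℕ, (a:ℝ) / n + ψ n / n - (a / n - ψ n / n) = 2 * ψ n / n := fun a => by ring
        simp only [this, Finset.sum_const, nsmul_eq_mul, C]
        ring
      · intro a _
        have : 0 ≤ ψ n / n := by positivity
        linarith
    have := ENNReal.toReal_mono hfin (measure_mono hsub)
    rw [hvol, ENNReal.toReal_ofReal (by positivity)] at this
    exact this
  · obtain rfl : n = 1 := by omega
    have hsub : Set.Ico 0 (ψ 1) ∪ Set.Ioc (1 - ψ 1) 1 ⊆ DSset ψ 1 := by
      rintro x (hx | hx)
      · refine ⟨?_, hx.1, by linarith [hx.2]⟩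
        simp only [Set.mem_iUnion]
        refine ⟨0, ⟨by norm_num, by norm_num⟩, ?_⟩
        simp only [Set.mem_Icc]
        norm_num
        exact ⟨by linarith [hx.1], hx.2.le⟩
      · refine ⟨?_, by linarith [hx.1], hx.2⟩
        simp only [Set.mem_iUnion]
        refine ⟨1, ⟨by norm_num, by norm_num⟩, ?_⟩
        simp only [Set.mem_Icc]
        norm_num
        exact ⟨by linarith [hx.1], by linarith [hx.2]⟩
    have hvol : volume (Set.Ico 0 (ψ 1) ∪ Set.Ioc (1 - ψ 1) 1) = ENNReal.ofReal (2 * ψ 1) := by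
      rw [measure_union _ measurableSet_Ioc, Real.volume_Ico, Real.volume_Ioc, ← ENNReal.ofReal_add]
      · congr 1; ring
      · linarith
      · linarith
      · rw [Set.disjoint_left]
        intro x hx hy
        linarith [hx.2, hy.1]
    have := ENNReal.toReal_mono hfin (measure_mono hsub)
    rw [hvol, ENNReal.toReal_ofReal (by positivity)] at this
    simpa using this

lemma trap_ge (x y α β : ℝ) (hα : 0 ≤ α) (hβ : 0 ≤ β) :
    min (x + α) (y + β) - max (x - α) (y - β) ≤ trap (α + β) |α - β| |x - y| := by
  unfold trap
  have a1 := min_le_left (x + α) (y + β)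
  have a2 := min_le_right (x + α) (y + β)
  have a3 := le_max_left (x - α) (y - β)
  have a4 := le_max_right (x - α) (y - β)
  rcases le_total (|α - β|) (|x - y|) with h | h
  · rw [max_eq_left (by linarith : |α - β| - |x - y| ≤ 0)]
    have := le_max_right 0 (α + β - |x - y|)
    rcases abs_cases (x - y) with ⟨h1, _⟩ | ⟨h1, _⟩ <;> linarith
  · rw [max_eq_right (by linarith : 0 ≤ |α - β| - |x - y|)]
    have := le_max_right 0 (α + β - |x - y|)
    rcases abs_cases (α - β) with ⟨h1, _⟩ | ⟨h1, _⟩ <;> linarith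

open Classical in
noncomputable def Prs (n m : ℕ) : Finset (ℕ × ℕ) :=
  ((Finset.range (n+1) ×ˢ Finset.range (m+1)).filter (fun x => Nat.Coprime x.1 n ∧ Nat.Coprime x.2 m))

lemma DSset_upper (ψ : ℕ → ℝ) (n m : ℕ) (hn : 0 < n) (hm : 0 < m) (h0 : 0 ≤ ψ n) (h1 : 0 ≤ ψ m) :
    (volume (DSset ψ n ∩ DSset ψ m)).toReal ≤ ∑ x ∈ Prs n m,
      trap (ψ n / n + ψ m / m) |ψ n / n - ψ m / m| |(x.1:ℝ) / n - x.2 / m| := by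
  have hA : |ψ n / n - ψ m / m| ≤ ψ n / n + ψ m / m := by
    have : 0 ≤ ψ n / n := by positivity
    have : 0 ≤ ψ m / m := by positivity
    rw [abs_le]; constructor <;> linarith
  have hsub : DSset ψ n ∩ DSset ψ m ⊆ ⋃ x ∈ Prs n m,
      (Set.Icc ((x.1 : ℝ) / n - ψ n / n) ((x.1 : ℝ) / n + ψ n / n) ∩
       Set.Icc ((x.2 : ℝ) / m - ψ m / m) ((x.2 : ℝ) / m + ψ m / m)) := by
    rintro t ⟨⟨ht1, _⟩, ⟨ht2, _⟩⟩
    simp only [Set.mem_iUnion] at ht1 ht2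
    obtain ⟨a, ha, ht1⟩ := ht1
    obtain ⟨b, hb, ht2⟩ := ht2
    simp only [Set.mem_iUnion]
    refine ⟨(a, b), ?_, ht1, ht2⟩
    simp only [Prs, Finset.mem_filter, Finset.mem_product, Finset.mem_range]
    exact ⟨⟨Nat.lt_succ_of_le ha.1, Nat.lt_succ_of_le hb.1⟩, ha.2, hb.2⟩
  have h := (measure_mono hsub).trans (measure_biUnion_finset_le (μ := volume) (Prs n m) _)
  have h2 : volume (DSset ψ n ∩ DSset ψ m) ≤ ENNReal.ofReal (∑ x ∈ Prs n m,
      trap (ψ n / n + ψ m / m) |ψ n / n - ψ m / m| |(x.1:ℝ) / n - x.2 / m|) := by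
    rw [ENNReal.ofReal_sum_of_nonneg (fun x _ => trap_nonneg hA _)]
    refine h.trans (Finset.sum_le_sum fun x _ => ?_)
    rw [Set.Icc_inter_Icc, Real.volume_Icc]
    apply ENNReal.ofReal_le_ofReal
    exact trap_ge _ _ _ _ (by positivity) (by positivity)
  exact ENNReal.toReal_le_of_le_ofReal (Finset.sum_nonneg fun x _ => trap_nonneg hA _) h2

lemma overlap_sum (ψ : ℕ → ℝ) (n m : ℕ) (hn : 0 < n) (hm : 0 < m) (hnm : n ≠ m) (h0 : 0 ≤ ψ n) (h1 : 0 ≤ ψ m)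
    (M : ℕ) (hM : n * m ≤ M) :
    (volume (DSset ψ n ∩ DSset ψ m)).toReal ≤ 2 * kap n m * ∑ c ∈ Finset.Icc 1 M,
      trap (ψ n / n + ψ m / m) |ψ n / n - ψ m / m| ((c:ℝ) / ((n:ℝ) * m / Nat.gcd n m)) *
      (∏ p ∈ ((n / Nat.gcd n m) * (m / Nat.gcd n m)).primeFactors, (1 - if p ∣ c then (1:ℝ) else 0)) *
      ∏ p ∈ (Nat.gcd n m).primeFactors \ ((n / Nat.gcd n m) * (m / Nat.gcd n m)).primeFactors,
        (betaf p * (if p ∣ c then (1:ℝ) else 0) + alphaf p) := by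
  classical
  refine (DSset_upper ψ n m hn hm h0 h1).trans ?_
  have hA : |ψ n / n - ψ m / m| ≤ ψ n / n + ψ m / m := by
    have : 0 ≤ ψ n / n := by positivity
    have : 0 ≤ ψ m / m := by positivity
    rw [abs_le]; constructor <;> linarith
  generalize ψ n / n + ψ m / m = A at *
  generalize |ψ n / n - ψ m / m| = B at *
  have hg : 0 < Nat.gcd n m := Nat.gcd_pos_of_pos_left _ hn
  have en : n / Nat.gcd n m * Nat.gcd n m = n := Nat.div_mul_cancel (Nat.gcd_dvd_left n m)
  have em : m / Nat.gcd n m * Nat.gcd n m = m := Nat.div_mul_cancel (Nat.gcd_dvd_right n m)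
  have hmem := Fib_mem n m
  have hcard := Fib_card n m hn hm hnm
  set g := Nat.gcd n m with hgdef
  set n' := n / g with hn'
  set m' := m / g with hm'
  have hn'0 : n' ≠ 0 := by intro h; rw [h] at en; omega
  have hm'0 : m' ≠ 0 := by intro h; rw [h] at em; omega
  set Q := n' * m' with hQ
  have hQ1 : Q ≠ 1 := by
    intro h
    have h1 : n' = 1 := Nat.dvd_one.1 ⟨m', h.symm⟩
    have h2 : m' = 1 := Nat.dvd_one.1 ⟨n', by rw [mul_comm]; exact h.symm⟩
    rw [h1] at en; rw [h2] at em; omega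
  have hQ0 : Q ≠ 0 := mul_ne_zero hn'0 hm'0
  let φ : ℕ × ℕ → ℤ := fun x => (x.1:ℤ) * m' - x.2 * n'
  let H : ℕ → ℝ := fun c => (∏ p ∈ Q.primeFactors, (1 - if p ∣ c then (1:ℝ) else 0)) *
      ∏ p ∈ g.primeFactors \ Q.primeFactors, (betaf p * (if p ∣ c then (1:ℝ) else 0) + alphaf p)
  have hH0 : H 0 = 0 := by
    simp only [H]
    rw [Finset.prod_eq_zero (i := Q.minFac)]
    · simp
    · exact Nat.mem_primeFactors.2 ⟨Nat.minFac_prime hQ1, Nat.minFac_dvd Q, hQ0⟩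
    · simp
  have hnr : (0:ℝ) < n := by exact_mod_cast hn
  have hmr : (0:ℝ) < m := by exact_mod_cast hm
  have hgr : (0:ℝ) < g := by exact_mod_cast hg
  have enr : (n':ℝ) * g = n := by exact_mod_cast en
  have emr : (m':ℝ) * g = m := by exact_mod_cast em
  have hφ : ∀ x : ℕ × ℕ, |(x.1:ℝ) / n - x.2 / m| = ((φ x).natAbs : ℝ) / ((n:ℝ) * m / g) := by
    intro x
    have e : (x.1:ℝ) / n - x.2 / m = ((x.1:ℝ) * m' - x.2 * n') / ((n:ℝ) * m / g) := by
      rw [← enr, ← emr] at *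
      have : (n':ℝ) ≠ 0 := by exact_mod_cast hn'0
      have : (m':ℝ) ≠ 0 := by exact_mod_cast hm'0
      field_simp
    rw [e, abs_div, abs_of_pos (by positivity : 0 < (n:ℝ) * m / g)]
    congr 1
    rw [Nat.cast_natAbs]
    push_cast
    simp [φ]
  simp only [hφ]
  have hmaps : ∀ x ∈ Prs n m, (φ x).natAbs ∈ Finset.range (M + 1) := by
    intro x hx
    simp only [Prs, Finset.mem_filter, Finset.mem_product, Finset.mem_range] at hx
    obtain ⟨⟨hx1, hx2⟩, _⟩ := hx
    have k1 : x.1 * m' ≤ n * m := Nat.mul_le_mul (by omega) (Nat.div_le_self _ _)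
    have k2 : x.2 * n' ≤ m * n := Nat.mul_le_mul (by omega) (Nat.div_le_self _ _)
    rw [mul_comm m n] at k2
    have k1' : (x.1:ℤ) * m' ≤ M := by exact_mod_cast k1.trans hM
    have k2' : (x.2:ℤ) * n' ≤ M := by exact_mod_cast k2.trans hM
    have k3 : (0:ℤ) ≤ (x.1:ℤ) * m' := by positivity
    have k4 : (0:ℤ) ≤ (x.2:ℤ) * n' := by positivity
    rw [Finset.mem_range]
    simp only [φ]
    omega
  rw [← Finset.sum_fiberwise_of_maps_to hmaps]
  have hfib : ∀ k : ℕ, (((Prs n m).filter (fun x => (φ x).natAbs = k)).card : ℝ) ≤ 2 * kap n m * H k := by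
    intro k
    have hsub : (Prs n m).filter (fun x => (φ x).natAbs = k) ⊆ Fib n m k ∪ Fib n m (-k) := by
      intro x hx
      simp only [Prs, Finset.mem_filter, Finset.mem_product, Finset.mem_range] at hx
      obtain ⟨⟨⟨hx1, hx2⟩, hx3, hx4⟩, hk⟩ := hx
      rw [Finset.mem_union, hmem, hmem]
      have : φ x = k ∨ φ x = -k := by omega
      rcases this with h | h
      · exact Or.inl ⟨by omega, by omega, hx3, hx4, h⟩
      · exact Or.inr ⟨by omega, by omega, hx3, hx4, h⟩
    have h1 := (Finset.card_le_card hsub).trans (Finset.card_union_le _ _)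
    have h2 : (((Prs n m).filter (fun x => (φ x).natAbs = k)).card : ℝ) ≤ (Fib n m k).card + (Fib n m (-k)).card := by
      exact_mod_cast h1
    have h3 := hcard k
    have h4 := hcard (-k)
    rw [Int.natAbs_neg] at h4
    rw [Int.natAbs_natCast] at h3 h4
    simp only [H]
    linarith
  calc _ = ∑ k ∈ Finset.range (M+1), (((Prs n m).filter (fun x => (φ x).natAbs = k)).card : ℝ) * trap A B ((k:ℝ) / ((n:ℝ) * m / g)) := by
        refine Finset.sum_congr rfl fun k _ => ?_
        rw [Finset.sum_congr rfl (g := fun _ => trap A B ((k:ℝ) / ((n:ℝ) * m / g)))]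
        · rw [Finset.sum_const, nsmul_eq_mul]
        · intro x hx
          rw [(Finset.mem_filter.1 hx).2]
    _ ≤ ∑ k ∈ Finset.range (M+1), 2 * kap n m * H k * trap A B ((k:ℝ) / ((n:ℝ) * m / g)) :=
        Finset.sum_le_sum fun k _ => mul_le_mul_of_nonneg_right (hfib k) (trap_nonneg hA _)
    _ = ∑ k ∈ Finset.Icc 1 M, 2 * kap n m * H k * trap A B ((k:ℝ) / ((n:ℝ) * m / g)) := by
        symm
        apply Finset.sum_subset
        · intro k hk; simp only [Finset.mem_Icc, Finset.mem_range] at *; omega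
        · intro k hk hk'
          have : k = 0 := by simp only [Finset.mem_Icc, Finset.mem_range] at *; omega
          rw [this, hH0]; ring
    _ = _ := by
        rw [Finset.mul_sum]
        refine Finset.sum_congr rfl fun k _ => ?_
        simp only [H]; ring

lemma prod_Icc_inv (K : ℕ) (hK : 1 ≤ K) : ∏ k ∈ Finset.Icc 2 K, (1 - 1 / (k:ℝ)) = 1 / K := by
  induction K, hK using Nat.le_induction with
  | base => simp
  | succ K hK ih =>
    rw [Finset.prod_Icc_succ_top (by omega), ih]
    have : (K:ℝ) ≠ 0 := by positivity
    push_cast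
    field_simp
    ring

lemma one_sub_inv_mem (p : ℕ) (hp : 2 ≤ p) : 0 < 1 - 1 / (p:ℝ) ∧ 1 - 1 / (p:ℝ) ≤ 1 := by
  have h2 : (2:ℝ) ≤ p := by exact_mod_cast hp
  have : 1 / (p:ℝ) ≤ 1 / 2 := one_div_le_one_div_of_le (by norm_num) h2
  have : 0 ≤ 1 / (p:ℝ) := by positivity
  constructor <;> linarith

lemma prod_anti (A B : Finset ℕ) (hAB : A ⊆ B) (f : ℕ → ℝ) (h0 : ∀ p ∈ B, 0 ≤ f p) (h1 : ∀ p ∈ B, f p ≤ 1) :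
    ∏ p ∈ B, f p ≤ ∏ p ∈ A, f p := by
  rw [← Finset.prod_sdiff hAB]
  apply mul_le_of_le_one_left (Finset.prod_nonneg fun p hp => h0 p (hAB hp))
  exact Finset.prod_le_one (fun p hp => h0 p (Finset.mem_sdiff.1 hp).1) fun p hp => h1 p (Finset.mem_sdiff.1 hp).1

lemma V_lower (z : ℝ) (hz : 1 ≤ z) (A : Finset ℕ) (hA : ∀ p ∈ A, p.Prime ∧ (p:ℝ) ≤ z) :
    1 / z ≤ ∏ p ∈ A, (1 - 1 / (p:ℝ)) := by
  have hK : 1 ≤ ⌊z⌋₊ := Nat.one_le_floor_iff z |>.2 hz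
  have h1 : 1 / z ≤ 1 / (⌊z⌋₊ : ℝ) := by
    apply one_div_le_one_div_of_le (by exact_mod_cast hK)
    exact Nat.floor_le (by linarith)
  rw [← prod_Icc_inv _ hK] at h1
  refine h1.trans (prod_anti A _ ?_ _ ?_ ?_)
  · intro p hp
    exact Finset.mem_Icc.2 ⟨(hA p hp).1.two_le, Nat.le_floor (hA p hp).2⟩
  · intro p hp; exact (one_sub_inv_mem p (Finset.mem_Icc.1 hp).1).1.le
  · intro p hp; exact (one_sub_inv_mem p (Finset.mem_Icc.1 hp).1).2

lemma exists_tower (z : ℝ) : ∃ j : ℕ, z < 2 ^ (4 ^ j) := by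
  obtain ⟨k, hk⟩ := pow_unbounded_of_one_lt z (by norm_num : (1:ℝ) < 2)
  refine ⟨k, hk.trans_le ?_⟩
  exact pow_le_pow_right₀ (by norm_num) (Nat.lt_pow_self (by norm_num)).le

lemma tau_bound (u : ℝ) (hu : Real.exp 448 ≤ u) :
    Real.exp (28 * (u + 2)) / u ^ (2 * ⌊3 * (u - 2) / 8⌋₊) ≤ u ^ (-(u/2)) := by
  have hu1 : (449:ℝ) ≤ u := by
    have := Real.add_one_le_exp (448:ℝ); linarith
  have hu0 : 0 < u := by linarith
  have hlog : 448 ≤ Real.log u := by rwa [Real.le_log_iff_exp_le hu0]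
  set b := ⌊3 * (u - 2) / 8⌋₊
  have hb : 3 * (u - 2) / 8 - 1 ≤ b := (Nat.sub_one_lt_floor _).le
  rw [div_le_iff₀ (by positivity), ← Real.rpow_natCast, ← Real.rpow_add hu0, Real.rpow_def_of_pos hu0,
    Real.exp_le_exp]
  push_cast
  have h1 : u / 8 ≤ -(u/2) + 2 * (b:ℝ) := by linarith
  calc 28 * (u + 2) ≤ 448 * (u / 8) := by linarith
    _ ≤ Real.log u * (-(u/2) + 2 * (b:ℝ)) := mul_le_mul hlog h1 (by linarith) (by linarith)

lemma sieve_choice : ∃ K1 : ℝ, 0 < K1 ∧ ∀ u T : ℝ, 1 ≤ u → 2 ≤ T → ∀ Q : ℕ,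
    ∃ (P : Finset ℕ) (ι : Type) (_ : Fintype ι) (S : ι → Finset ℕ) (l : ι → ℝ),
      P ⊆ Q.primeFactors ∧ (∀ i, S i ⊆ P) ∧ (∀ i, |l i| ≤ 1) ∧
      (∀ x : ℕ → ℝ, (∀ p ∈ P, 0 ≤ x p ∧ x p ≤ 1) → ∏ p ∈ P, (1 - x p) ≤ ∑ i, l i * ∏ p ∈ S i, x p) ∧
      ∑ i, l i * ∏ p ∈ S i, (1 / (p:ℝ)) ≤
        (∏ p ∈ Q.primeFactors.filter (fun p : ℕ => (p:ℝ) ≤ T), (1 - 1 / (p:ℝ))) * (1 + K1 * u ^ (-(u/2))) ∧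
      (Fintype.card ι : ℝ) ≤ K1 * (∏ p ∈ Q.primeFactors.filter (fun p : ℕ => (p:ℝ) ≤ T), (1 - 1 / (p:ℝ))) * T ^ u := by
  set u0 : ℝ := Real.exp 448 with hu0
  have hu0pos : 0 < u0 := Real.exp_pos _
  set C1 : ℝ := Real.exp 56 * Real.exp (Real.exp 112) with hC1
  have hC1pos : 0 < C1 := by positivity
  have hKK : 0 < C1 * u0 ^ (u0/2) := mul_pos hC1pos (Real.rpow_pos_of_pos hu0pos _)
  have he56 := Real.exp_pos 56
  refine ⟨2 + Real.exp 56 + C1 * u0 ^ (u0/2), by positivity, ?_⟩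
  set K1 := 2 + Real.exp 56 + C1 * u0 ^ (u0/2) with hK1
  intro u T hu hT Q
  have hupos : 0 < u := by linarith
  have hpr : ∀ p ∈ Q.primeFactors, p.Prime := fun p hp => Nat.prime_of_mem_primeFactors hp
  have hVT : 1 / T ≤ ∏ p ∈ Q.primeFactors.filter (fun p : ℕ => (p:ℝ) ≤ T), (1 - 1 / (p:ℝ)) := by
    apply V_lower T (by linarith)
    intro p hp
    rw [Finset.mem_filter] at hp
    exact ⟨hpr p hp.1, hp.2⟩
  have hVTpos : 0 < ∏ p ∈ Q.primeFactors.filter (fun p : ℕ => (p:ℝ) ≤ T), (1 - 1 / (p:ℝ)) :=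
    lt_of_lt_of_le (by positivity) hVT
  rcases le_or_gt u0 u with hcase | hcase
  · -- large u
    have hu449 : (449:ℝ) ≤ u := by
      have := Real.add_one_le_exp (448:ℝ); linarith
    obtain ⟨j, hj⟩ := exists_tower T
    obtain ⟨ι, hι, S, l, a1, a2, a3, a4, a5⟩ := full_sieve u (by linarith) j T (by linarith) hj ⌊3 * (u - 2) / 8⌋₊
      (Q.primeFactors.filter (fun p : ℕ => (p:ℝ) ≤ T)) (by
        intro p hp
        rw [Finset.mem_filter] at hp
        exact ⟨hpr p hp.1, hp.2⟩)
    refine ⟨_, ι, hι, S, l, Finset.filter_subset _ _, a1, a2, a4, ?_, ?_⟩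
    · refine a5.trans (mul_le_mul_of_nonneg_left ?_ hVTpos.le)
      have ht := tau_bound u hcase
      set τ := Real.exp (28 * (u + 2)) / u ^ (2 * ⌊3 * (u - 2) / 8⌋₊)
      have hτ0 : 0 ≤ τ := by positivity
      have hle1 : u ^ (-(u/2)) ≤ 1 := Real.rpow_le_one_of_one_le_of_nonpos hu (by linarith)
      have h2 : Real.exp τ ≤ 1 + 2 * τ := by
        have := Real.abs_exp_sub_one_le (x := τ) (by rw [abs_of_nonneg hτ0]; linarith)
        rw [abs_of_nonneg hτ0] at this
        linarith [le_abs_self (Real.exp τ - 1)]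
      have h3 : 2 * u ^ (-(u/2)) ≤ K1 * u ^ (-(u/2)) := by
        apply mul_le_mul_of_nonneg_right _ (by positivity)
        rw [hK1]; linarith
      linarith
    · refine a3.trans ?_
      have hb : ((⌊3 * (u - 2) / 8⌋₊ : ℕ) : ℝ) ≤ 3 * (u - 2) / 8 := Nat.floor_le (by linarith)
      have h1 : T ^ (8 * ((⌊3 * (u - 2) / 8⌋₊ : ℕ) : ℝ) / 3 + 1) ≤ T ^ (u - 1) :=
        Real.rpow_le_rpow_of_exponent_le (by linarith) (by linarith)
      have h2 : T ^ (u - 1) = 1 / T * T ^ u := by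
        rw [Real.rpow_sub (by linarith), Real.rpow_one]; ring
      refine h1.trans ?_
      rw [h2]
      apply mul_le_mul_of_nonneg_right _ (by positivity)
      refine hVT.trans (le_mul_of_one_le_left hVTpos.le ?_)
      rw [hK1]; linarith
  · -- bounded u
    have hz4 : (T ^ (1/4:ℝ)) ^ 4 = T := by
      rw [← Real.rpow_natCast, ← Real.rpow_mul (by linarith)]; norm_num
    have hz1 : 1 ≤ T ^ (1/4:ℝ) := Real.one_le_rpow (by linarith) (by norm_num)
    generalize T ^ (1/4:ℝ) = z at hz4 hz1
    have hzT : z ≤ T := by rw [← hz4]; exact le_self_pow₀ hz1 (by norm_num)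
    obtain ⟨j, hj⟩ := exists_tower z
    have hPz : ∀ p ∈ Q.primeFactors.filter (fun p : ℕ => (p:ℝ) ≤ z), p.Prime ∧ (p:ℝ) ≤ z := by
      intro p hp
      rw [Finset.mem_filter] at hp
      exact ⟨hpr p hp.1, hp.2⟩
    obtain ⟨ι, hι, S, l, a1, a2, a3, a4, a5⟩ := full_sieve 2 le_rfl j z hz1 hj 0 _ hPz
    have hVz := V_lower z hz1 _ hPz
    have hsub : Q.primeFactors.filter (fun p : ℕ => (p:ℝ) ≤ z) ⊆ Q.primeFactors.filter (fun p : ℕ => (p:ℝ) ≤ T) := by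
      intro p hp
      rw [Finset.mem_filter] at hp ⊢
      exact ⟨hp.1, hp.2.trans hzT⟩
    have hsplit := Finset.prod_sdiff (f := fun p : ℕ => 1 - 1 / (p:ℝ)) hsub
    have hW := prod_lower (Q.primeFactors.filter (fun p : ℕ => (p:ℝ) ≤ T) \ Q.primeFactors.filter (fun p : ℕ => (p:ℝ) ≤ z)) (by
      intro p hp
      exact hpr p (Finset.mem_filter.1 (Finset.mem_sdiff.1 hp).1).1) 28 (by
      apply prime_sum z hz1
      intro p hp
      rw [Finset.mem_sdiff, Finset.mem_filter, Finset.mem_filter] at hp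
      refine ⟨hpr p hp.1.1, ?_, by rw [hz4]; exact hp.1.2⟩
      by_contra h
      exact hp.2 ⟨hp.1.1, not_lt.1 h⟩)
    refine ⟨_, ι, hι, S, l, Finset.filter_subset _ _, a1, a2, a4, ?_, ?_⟩
    all_goals
      generalize (∏ p ∈ Q.primeFactors.filter (fun p : ℕ => (p:ℝ) ≤ T), (1 - 1 / (p:ℝ))) = VT at *
      generalize (∏ p ∈ Q.primeFactors.filter (fun p : ℕ => (p:ℝ) ≤ z), (1 - 1 / (p:ℝ))) = Vz at *
      generalize (∏ p ∈ (Q.primeFactors.filter (fun p : ℕ => (p:ℝ) ≤ T) \ Q.primeFactors.filter (fun p : ℕ => (p:ℝ) ≤ z)), (1 - 1 / (p:ℝ))) = W at *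
      have hVz0 : 0 < Vz := lt_of_lt_of_le (by positivity) hVz
      have hVzT : Vz ≤ Real.exp 56 * VT := by
        have e : Real.exp 56 * Real.exp (-(2*28)) = 1 := by rw [← Real.exp_add]; norm_num
        rw [← hsplit]
        calc Vz = Real.exp 56 * Real.exp (-(2*28)) * Vz := by rw [e, one_mul]
          _ ≤ Real.exp 56 * W * Vz := by gcongr
          _ = _ := by ring
    · have e0 : Real.exp (Real.exp (28 * (2 + 2)) / 2 ^ (2 * 0)) = Real.exp (Real.exp 112) := by norm_num
      rw [e0] at a5
      refine a5.trans ?_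
      have q1 : Vz * Real.exp (Real.exp 112) ≤ VT * C1 := by
        calc _ ≤ (Real.exp 56 * VT) * Real.exp (Real.exp 112) := mul_le_mul_of_nonneg_right hVzT (Real.exp_pos _).le
          _ = _ := by rw [hC1]; ring
      refine q1.trans (mul_le_mul_of_nonneg_left ?_ hVTpos.le)
      have q2 : u ^ (u/2) ≤ u0 ^ (u0/2) :=
        (Real.rpow_le_rpow hupos.le hcase.le (by linarith)).trans
          (Real.rpow_le_rpow_of_exponent_le (by linarith) (by linarith))
      have q3 : u ^ (-(u/2)) * u ^ (u/2) = 1 := by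
        rw [← Real.rpow_add hupos]; simp
      have q5 : 0 < u ^ (-(u/2)) := Real.rpow_pos_of_pos hupos _
      have q4 : 1 ≤ u ^ (-(u/2)) * u0 ^ (u0/2) := by
        rw [← q3]; gcongr
      have q6 : C1 * 1 ≤ C1 * (u ^ (-(u/2)) * u0 ^ (u0/2)) := mul_le_mul_of_nonneg_left q4 hC1pos.le
      have q7 : 0 ≤ (2 + Real.exp 56) * u ^ (-(u/2)) := by positivity
      rw [hK1]
      linarith
    · have e0 : (8 * ((0:ℕ):ℝ) / 3 + 1) = 1 := by norm_num
      rw [e0, Real.rpow_one] at a3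
      refine a3.trans ?_
      have q1 : T ≤ T ^ u := by
        calc T = T ^ (1:ℝ) := (Real.rpow_one T).symm
          _ ≤ _ := Real.rpow_le_rpow_of_exponent_le (by linarith) hu
      have q2 : z * z ≤ T := by rw [← hz4]; nlinarith [mul_self_nonneg (z*z - 1), mul_le_mul hz1 hz1 (by norm_num) (by linarith)]
      have q3 : 1 / z * T ≤ (Real.exp 56 * VT) * T ^ u :=
        mul_le_mul (hVz.trans hVzT) q1 (by linarith) (by positivity)
      have q4 : z ≤ 1 / z * T := by
        rw [one_div, ← div_eq_inv_mul, le_div_iff₀ (by linarith)]; exact q2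
      refine q4.trans (q3.trans ?_)
      have : Real.exp 56 ≤ K1 := by rw [hK1]; linarith
      gcongr

lemma overlap_main (ψ : ℕ → ℝ) (n m : ℕ) (hn : 0 < n) (hm : 0 < m) (hnm : n ≠ m) (h0 : 0 ≤ ψ n) (h1 : 0 ≤ ψ m)
    (hD : 0 < Dfun ψ n m) (P : Finset ℕ) (ι : Type) [Fintype ι] (S : ι → Finset ℕ) (l : ι → ℝ)
    (hP : P ⊆ ((n / Nat.gcd n m) * (m / Nat.gcd n m)).primeFactors) (hS : ∀ i, S i ⊆ P) (hl : ∀ i, |l i| ≤ 1)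
    (hsieve : ∀ x : ℕ → ℝ, (∀ p ∈ P, 0 ≤ x p ∧ x p ≤ 1) →
      ∏ p ∈ P, (1 - x p) ≤ ∑ i, l i * ∏ p ∈ S i, x p) :
    (volume (DSset ψ n ∩ DSset ψ m)).toReal ≤
      (2 * (Nat.totient n : ℝ) * ψ n / n) * (2 * (Nat.totient m : ℝ) * ψ m / m) /
        (∏ p ∈ ((n / Nat.gcd n m) * (m / Nat.gcd n m)).primeFactors, (1 - 1 / (p:ℝ))) *
      ((∑ i, l i * ∏ p ∈ S i, (1 / (p:ℝ))) + Fintype.card ι *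
        Gsum betaf ((Nat.gcd n m).primeFactors \ ((n / Nat.gcd n m) * (m / Nat.gcd n m)).primeFactors) (2 * Dfun ψ n m) /
          Dfun ψ n m) := by
  have hg : 0 < Nat.gcd n m := Nat.gcd_pos_of_pos_left _ hn
  have hnr : (0:ℝ) < n := by exact_mod_cast hn
  have hmr : (0:ℝ) < m := by exact_mod_cast hm
  have hgr : (0:ℝ) < Nat.gcd n m := by exact_mod_cast hg
  have hN : 0 < (n:ℝ) * m / Nat.gcd n m := by positivity
  have hα : 0 ≤ ψ n / n := by positivity
  have hβ : 0 ≤ ψ m / m := by positivity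
  have hDeq : Dfun ψ n m = max (ψ n / n) (ψ m / m) * ((n:ℝ) * m / Nat.gcd n m) := by
    unfold Dfun
    rw [max_mul_of_nonneg _ _ hN.le, ← max_div_div_right hgr.le]
    congr 1 <;> field_simp
  have hkap : kap n m = (Nat.totient n : ℝ) * Nat.totient m / (((n:ℝ) * m / Nat.gcd n m) *
    ∏ p ∈ ((n / Nat.gcd n m) * (m / Nat.gcd n m)).primeFactors, (1 - 1 / (p:ℝ))) := rfl
  have hsum := overlap_sum ψ n m hn hm hnm h0 h1 (max (n * m) ⌈(ψ n / n + ψ m / m) * ((n:ℝ) * m / Nat.gcd n m)⌉₊) (le_max_left _ _)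
  have hM : (ψ n / n + ψ m / m) * ((n:ℝ) * m / Nat.gcd n m) ≤
      ((max (n * m) ⌈(ψ n / n + ψ m / m) * ((n:ℝ) * m / Nat.gcd n m)⌉₊ : ℕ) : ℝ) :=
    (Nat.le_ceil _).trans (by exact_mod_cast le_max_right _ _)
  have hVQ : 0 < ∏ p ∈ ((n / Nat.gcd n m) * (m / Nat.gcd n m)).primeFactors, (1 - 1 / (p:ℝ)) :=
    Finset.prod_pos fun p hp => (one_sub_inv_mem p (Nat.prime_of_mem_primeFactors hp).two_le).1
  have e1 : 2 * (Nat.totient n : ℝ) * ψ n / n = 2 * (Nat.totient n : ℝ) * (ψ n / n) := by ring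
  have e2 : 2 * (Nat.totient m : ℝ) * ψ m / m = 2 * (Nat.totient m : ℝ) * (ψ m / m) := by ring
  rw [e1, e2]
  have hkn : 0 ≤ kap n m := by rw [hkap]; positivity
  generalize max (n * m) ⌈(ψ n / n + ψ m / m) * ((n:ℝ) * m / Nat.gcd n m)⌉₊ = M at *
  generalize Dfun ψ n m = D at *
  generalize (n:ℝ) * m / Nat.gcd n m = N at *
  generalize ψ n / n = α at *
  generalize ψ m / m = β at *
  have hR : ∀ p ∈ (Nat.gcd n m).primeFactors \ ((n / Nat.gcd n m) * (m / Nat.gcd n m)).primeFactors, p.Prime :=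
    fun p hp => Nat.prime_of_mem_primeFactors (Finset.mem_sdiff.1 hp).1
  have hRQ : Disjoint ((Nat.gcd n m).primeFactors \ ((n / Nat.gcd n m) * (m / Nat.gcd n m)).primeFactors) P :=
    Finset.disjoint_of_subset_right hP Finset.sdiff_disjoint
  have hPp : ∀ p ∈ P, p.Prime := fun p hp => Nat.prime_of_mem_primeFactors (hP hp)
  generalize (Nat.gcd n m).primeFactors \ ((n / Nat.gcd n m) * (m / Nat.gcd n m)).primeFactors = R at *
  generalize ((n / Nat.gcd n m) * (m / Nat.gcd n m)).primeFactors = Qf at *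
  have hBA : |α - β| ≤ α + β := by rw [abs_le]; constructor <;> linarith
  have hcore := core_sum (α + β) |α - β| N (abs_nonneg _) hBA hN M hM R P hR hPp hRQ ι S l hS hl hsieve
  have hcmp : ∑ c ∈ Finset.Icc 1 M, trap (α + β) |α - β| (c / N) * (∏ p ∈ Qf, (1 - if p ∣ c then (1:ℝ) else 0)) *
      ∏ p ∈ R, (betaf p * (if p ∣ c then (1:ℝ) else 0) + alphaf p) ≤
      ∑ c ∈ Finset.Icc 1 M, trap (α + β) |α - β| (c / N) * (∏ p ∈ P, (1 - if p ∣ c then (1:ℝ) else 0)) *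
      ∏ p ∈ R, (betaf p * (if p ∣ c then (1:ℝ) else 0) + alphaf p) := by
    apply Finset.sum_le_sum
    intro c _
    apply mul_le_mul_of_nonneg_right _ (Finset.prod_nonneg fun p hp => fR_nonneg p (hR p hp) c)
    apply mul_le_mul_of_nonneg_left _ (trap_nonneg hBA _)
    apply prod_anti P Qf hP
    · intro p _; split_ifs <;> norm_num
    · intro p _; split_ifs <;> norm_num
  have hbn : ∀ p, 0 ≤ betaf p := fun p => by unfold betaf; positivity
  have hAN : (α + β) * N ≤ 2 * D := by
    rw [hDeq]
    have := le_max_left α β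
    have := le_max_right α β
    nlinarith
  have hG := Gsum_mono betaf hbn R hAN
  have hG0 := Gsum_nonneg betaf hbn R ((α + β) * N)
  have hABD : ((α + β) - |α - β|) * D = 2 * α * β * N := by
    rw [hDeq]
    rcases le_total α β with h | h
    · rw [max_eq_right h, abs_of_nonpos (by linarith)]; ring
    · rw [max_eq_left h, abs_of_nonneg (by linarith)]; ring
  have hsq : (α + β) ^ 2 - |α - β| ^ 2 = 4 * α * β := by rw [sq_abs]; ring
  rw [hsq] at hcore
  refine hsum.trans ?_
  have hstep := mul_le_mul_of_nonneg_left (hcmp.trans hcore) (by positivity : 0 ≤ 2 * kap n m)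
  refine hstep.trans ?_
  generalize ∑ i, l i * ∏ p ∈ S i, (1 / (p:ℝ)) = Φ at *
  have hcard : (0:ℝ) ≤ Fintype.card ι := Nat.cast_nonneg _
  generalize (Fintype.card ι : ℝ) = k at *
  generalize Gsum betaf R ((α + β) * N) = G1 at *
  generalize Gsum betaf R (2 * D) = G2 at *
  generalize ∏ p ∈ Qf, (1 - 1 / (p:ℝ)) = V at *
  have hAB2 : (α + β) - |α - β| = 2 * α * β * N / D := by rw [eq_div_iff hD.ne']; exact hABD
  rw [hAB2, hkap]
  have hle : 2 * α * β * N / D * k * G1 ≤ 2 * α * β * N / D * k * G2 := by gcongr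
  have hkn' : 0 ≤ 2 * ((Nat.totient n : ℝ) * Nat.totient m / (N * V)) := by positivity
  calc _ ≤ 2 * ((Nat.totient n : ℝ) * Nat.totient m / (N * V)) * (N * (4 * α * β) / 2 * Φ + 2 * α * β * N / D * k * G2) := by
        apply mul_le_mul_of_nonneg_left _ hkn'
        linarith
    _ = _ := by field_simp; ring

lemma Gsum_D (R : Finset ℕ) (hR : ∀ p ∈ R, p.Prime) (D : ℝ) (hD : 0 < D) :
    Gsum betaf R (2 * D) ≤ 5 * Real.exp 8 * Real.log (D + 2) := by
  have hbn : ∀ p, 0 ≤ betaf p := fun p => by unfold betaf; positivity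
  have h1 := (Gsum_mono betaf hbn R (le_max_left (2*D) 1)).trans (Gsum_beta R hR _ (le_max_right (2*D) 1))
  refine h1.trans ?_
  have h2 : Real.log (max (2*D) 1) ≤ Real.log (2 * (D + 2)) :=
    Real.log_le_log (by positivity) (max_le (by linarith) (by linarith))
  rw [Real.log_mul (by norm_num) (by linarith)] at h2
  have h3 := Real.log_two_lt_d9
  have h4 := Real.log_two_gt_d9
  have h5 : Real.log 2 ≤ Real.log (D + 2) := Real.log_le_log (by norm_num) (by linarith)
  have h6 : 1 + Real.log (max (2*D) 1) ≤ 5 * Real.log (D + 2) := by linarith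
  calc _ ≤ Real.exp 8 * (5 * Real.log (D + 2)) := mul_le_mul_of_nonneg_left h6 (Real.exp_pos _).le
    _ = _ := by ring


/-- **Overlap estimate**: for `n ≠ m`, `u ≥ 1`, `T ≥ 2`,
`λ(𝒜_n ∩ 𝒜_m) ≤ λ(𝒜_n) λ(𝒜_m) (1 + O(u^{-u/2} + T^u log(D+2) log T / D))
  ∏_{p | nm/gcd(n,m)², p > T} (1 + 1/(p-1))` with an absolute implied constant. -/
theorem overlap_estimate :
    ∃ K : ℝ, 0 < K ∧ ∀ (ψ : ℕ → ℝ), (∀ n, ψ n ∈ Set.Icc (0:ℝ) (1/2)) →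
      ∀ (n m : ℕ), 0 < n → 0 < m → n ≠ m → ∀ (u T : ℝ), 1 ≤ u → 2 ≤ T →
      (volume (DSset ψ n ∩ DSset ψ m)).toReal ≤
        (volume (DSset ψ n)).toReal * (volume (DSset ψ m)).toReal *
          (1 + K * (u ^ (-(u / 2)) +
            T ^ u * Real.log (Dfun ψ n m + 2) * Real.log T / Dfun ψ n m)) *
          ∏ p ∈ (n * m / Nat.gcd n m ^ 2).primeFactors,
            Set.mulIndicator {q : ℕ | T < (q : ℝ)}
              (fun q => 1 + 1 / ((q : ℝ) - 1)) p := by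
  obtain ⟨K1, hK1, hchoice⟩ := sieve_choice
  have hE8 := Real.exp_pos 8
  refine ⟨K1 + 10 * Real.exp 8 * K1, by positivity, ?_⟩
  intro ψ hψ n m hn hm hnm u T hu hT
  have h0 := (hψ n).1
  have h1 := (hψ m).1
  have hg : 0 < Nat.gcd n m := Nat.gcd_pos_of_pos_left _ hn
  have hnr : (0:ℝ) < n := by exact_mod_cast hn
  have hmr : (0:ℝ) < m := by exact_mod_cast hm
  have hgr : (0:ℝ) < Nat.gcd n m := by exact_mod_cast hg
  have hQ : n * m / Nat.gcd n m ^ 2 = (n / Nat.gcd n m) * (m / Nat.gcd n m) := by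
    rw [pow_two, Nat.div_mul_div_comm (Nat.gcd_dvd_left n m) (Nat.gcd_dvd_right n m)]
  rw [hQ]
  have hD0 : 0 ≤ Dfun ψ n m := by unfold Dfun; positivity
  have hlogT : 1 / 2 ≤ Real.log T := by
    have h4 := Real.log_two_gt_d9
    have h5 : Real.log 2 ≤ Real.log T := Real.log_le_log (by norm_num) hT
    linarith
  have hlogD : 0 ≤ Real.log (Dfun ψ n m + 2) := Real.log_nonneg (by linarith)
  have hTu : 0 < T ^ u := Real.rpow_pos_of_pos (by linarith) _
  have huu : 0 < u ^ (-(u/2)) := Real.rpow_pos_of_pos (by linarith) _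
  have hprod : ∏ p ∈ ((n / Nat.gcd n m) * (m / Nat.gcd n m)).primeFactors,
      Set.mulIndicator {q : ℕ | T < (q : ℝ)} (fun q => 1 + 1 / ((q : ℝ) - 1)) p =
      (∏ p ∈ ((n / Nat.gcd n m) * (m / Nat.gcd n m)).primeFactors.filter (fun p : ℕ => (p:ℝ) ≤ T), (1 - 1 / (p:ℝ))) /
      ∏ p ∈ ((n / Nat.gcd n m) * (m / Nat.gcd n m)).primeFactors, (1 - 1 / (p:ℝ)) := by
    rw [Finset.prod_filter, ← Finset.prod_div_distrib]
    refine Finset.prod_congr rfl fun p hp => ?_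
    have h2 : (2:ℝ) ≤ p := by exact_mod_cast (Nat.prime_of_mem_primeFactors hp).two_le
    have h3 := (one_sub_inv_mem p (Nat.prime_of_mem_primeFactors hp).two_le).1
    by_cases h : T < (p:ℝ)
    · rw [Set.mulIndicator_of_mem (by exact h), if_neg (not_le.2 h)]
      have : (p:ℝ) - 1 ≠ 0 := by linarith
      have : (p:ℝ) ≠ 0 := by linarith
      rw [eq_div_iff h3.ne']
      field_simp
      ring
    · rw [Set.mulIndicator_of_notMem (by exact h), if_pos (not_lt.1 h), div_self h3.ne']
  rw [hprod]
  have hVQ : 0 < ∏ p ∈ ((n / Nat.gcd n m) * (m / Nat.gcd n m)).primeFactors, (1 - 1 / (p:ℝ)) :=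
    Finset.prod_pos fun p hp => (one_sub_inv_mem p (Nat.prime_of_mem_primeFactors hp).two_le).1
  have hVT : 0 < ∏ p ∈ ((n / Nat.gcd n m) * (m / Nat.gcd n m)).primeFactors.filter (fun p : ℕ => (p:ℝ) ≤ T), (1 - 1 / (p:ℝ)) :=
    Finset.prod_pos fun p hp => (one_sub_inv_mem p (Nat.prime_of_mem_primeFactors (Finset.mem_filter.1 hp).1).two_le).1
  rcases hD0.eq_or_lt with hD | hD
  · have hz : ψ n = 0 ∧ ψ m = 0 := by
      unfold Dfun at hD
      have hmax : max ((m:ℝ) * ψ n) (n * ψ m) = 0 := by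
        rcases div_eq_zero_iff.1 hD.symm with h | h
        · exact h
        · exact absurd h hgr.ne'
      have a1 := le_max_left ((m:ℝ) * ψ n) (n * ψ m)
      have a2 := le_max_right ((m:ℝ) * ψ n) (n * ψ m)
      rw [hmax] at a1 a2
      constructor
      · exact le_antisymm (nonpos_of_mul_nonpos_right a1 hmr) h0
      · exact le_antisymm (nonpos_of_mul_nonpos_right a2 hnr) h1
    have hL : (volume (DSset ψ n ∩ DSset ψ m)).toReal ≤ 0 := by
      refine (DSset_upper ψ n m hn hm h0 h1).trans ?_
      rw [hz.1, hz.2]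
      apply Finset.sum_nonpos
      intro x _
      simp [trap]
    refine hL.trans ?_
    rw [← hD]
    positivity
  · obtain ⟨P, ι, hι, S, l, b1, b2, b3, b4, b5, b6⟩ := hchoice u T hu hT ((n / Nat.gcd n m) * (m / Nat.gcd n m))
    have hmain := overlap_main ψ n m hn hm hnm h0 h1 hD P ι S l b1 b2 b3 b4
    have hG := Gsum_D ((Nat.gcd n m).primeFactors \ ((n / Nat.gcd n m) * (m / Nat.gcd n m)).primeFactors)
      (fun p hp => Nat.prime_of_mem_primeFactors (Finset.mem_sdiff.1 hp).1) (Dfun ψ n m) hD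
    have hln := DSset_lower ψ n hn h0 (hψ n).2
    have hlm := DSset_lower ψ m hm h1 (hψ m).2
    have hln0 : 0 ≤ 2 * (Nat.totient n : ℝ) * ψ n / n := by positivity
    have hlm0 : 0 ≤ 2 * (Nat.totient m : ℝ) * ψ m / m := by positivity
    generalize 2 * (Nat.totient n : ℝ) * ψ n / n = x at *
    generalize 2 * (Nat.totient m : ℝ) * ψ m / m = y at *
    generalize Gsum betaf ((Nat.gcd n m).primeFactors \ ((n / Nat.gcd n m) * (m / Nat.gcd n m)).primeFactors) (2 * Dfun ψ n m) = G at *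
    generalize ∏ p ∈ ((n / Nat.gcd n m) * (m / Nat.gcd n m)).primeFactors.filter (fun p : ℕ => (p:ℝ) ≤ T), (1 - 1 / (p:ℝ)) = VT at *
    generalize ∏ p ∈ ((n / Nat.gcd n m) * (m / Nat.gcd n m)).primeFactors, (1 - 1 / (p:ℝ)) = VQ at *
    generalize ∑ i, l i * ∏ p ∈ S i, (1 / (p:ℝ)) = Φ at *
    have hcard : (0:ℝ) ≤ Fintype.card ι := Nat.cast_nonneg _
    generalize (Fintype.card ι : ℝ) = k at *
    generalize Dfun ψ n m = D at *
    generalize T ^ u = W at *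
    generalize u ^ (-(u/2)) = U at *
    generalize Real.log (D + 2) = L at *
    generalize Real.log T = L' at *
    generalize Real.exp 8 = e at *
    have hxy : x * y ≤ (volume (DSset ψ n)).toReal * (volume (DSset ψ m)).toReal :=
      mul_le_mul hln hlm hlm0 ENNReal.toReal_nonneg
    have hbr : Φ + k * G / D ≤ VT * (1 + (K1 + 10 * e * K1) * (U + W * L * L' / D)) := by
      have c1 : k * G ≤ (K1 * VT * W) * (5 * e * L) :=
        (mul_le_mul_of_nonneg_left hG hcard).trans (mul_le_mul_of_nonneg_right b6 (by positivity))
      have c2 : (K1 * VT * W) * (5 * e * L) ≤ (K1 * VT * W) * (5 * e * L) * (2 * L') :=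
        le_mul_of_one_le_right (by positivity) (by linarith)
      have c3 : k * G / D ≤ (K1 * VT * W) * (5 * e * L) * (2 * L') / D :=
        div_le_div_of_nonneg_right (c1.trans c2) hD.le
      have c4 : (K1 * VT * W) * (5 * e * L) * (2 * L') / D = VT * (10 * e * K1 * (W * L * L' / D)) := by ring
      have c5 : 0 ≤ VT * (K1 * (W * L * L' / D)) := by
        have : 0 ≤ L' := by linarith
        positivity
      have c6 : 0 ≤ VT * (10 * e * K1 * U) := by positivity
      rw [c4] at c3
      nlinarith
    have hnn : 0 ≤ VT * (1 + (K1 + 10 * e * K1) * (U + W * L * L' / D)) := by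
      have : 0 ≤ L' := by linarith
      positivity
    calc _ ≤ x * y / VQ * (Φ + k * G / D) := hmain
      _ ≤ x * y / VQ * (VT * (1 + (K1 + 10 * e * K1) * (U + W * L * L' / D))) :=
        mul_le_mul_of_nonneg_left hbr (by positivity)
      _ ≤ (volume (DSset ψ n)).toReal * (volume (DSset ψ m)).toReal / VQ * (VT * (1 + (K1 + 10 * e * K1) * (U + W * L * L' / D))) :=
        mul_le_mul_of_nonneg_right (div_le_div_of_nonneg_right hxy hVQ.le) hnn
      _ = _ := by ring
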